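/- arXiv:2204.00093 — 8 statements merged into one kernel-verified Lean document; each statement's English description precedes it below -/
import Mathlib

section
/- Let G be a triangle-free simple graph on n vertices. Then the smallest eigenvalue q_n(G) of the signless Laplacian matrix of G satisfies q_n(G) ≤ (15/94)·n. -/
open Finset Matrix

namespace TriangleFreeSignless

/-- Integer functions of the ten edge indicators `01, 02, 03, 04, 12, 13, 14, 23, 24, 34` of a
graph on five labelled vertices. -/
abbrev EdgeFun : Type :=
  Bool → Bool → Bool → Bool → Bool → Bool → Bool → Bool → Bool → Bool → ℤ

/-- Relabelling of an `EdgeFun` by the transposition `(0 1)`. -/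
def swap01 (F : EdgeFun) : EdgeFun := fun a01 a02 a03 a04 a12 a13 a14 a23 a24 a34 =>
  F a01 a12 a13 a14 a02 a03 a04 a23 a24 a34

/-- Relabelling of an `EdgeFun` by the transposition `(1 2)`. -/
def swap12 (F : EdgeFun) : EdgeFun := fun a01 a02 a03 a04 a12 a13 a14 a23 a24 a34 =>
  F a02 a01 a03 a04 a12 a23 a24 a13 a14 a34

/-- Relabelling of an `EdgeFun` by the transposition `(2 3)`. -/
def swap23 (F : EdgeFun) : EdgeFun := fun a01 a02 a03 a04 a12 a13 a14 a23 a24 a34 =>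
  F a01 a03 a02 a04 a13 a12 a14 a23 a34 a24

/-- Relabelling of an `EdgeFun` by the transposition `(3 4)`. -/
def swap34 (F : EdgeFun) : EdgeFun := fun a01 a02 a03 a04 a12 a13 a14 a23 a24 a34 =>
  F a01 a02 a04 a03 a12 a14 a13 a24 a23 a34

/-- The sum of an `EdgeFun` over all relabellings of the five vertices. -/
def symmetrize (F : EdgeFun) : EdgeFun :=
  let F₂ := F + swap01 F
  let F₃ := F₂ + swap12 F₂ + swap01 (swap12 F₂)
  let F₄ := F₃ + swap23 F₃ + swap12 (swap23 F₃) + swap01 (swap12 (swap23 F₃))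
  F₄ + swap34 F₄ + swap23 (swap34 F₄) + swap12 (swap23 (swap34 F₄)) +
    swap01 (swap12 (swap23 (swap34 F₄)))

section Total

variable {V : Type*} [Fintype V] (A : V → V → Bool)

/-- The sum of `F` over all (not necessarily injective) labelled `5`-tuples of vertices. -/
def total (F : EdgeFun) : ℤ :=
  ∑ a, ∑ b, ∑ c, ∑ d, ∑ e, F (A a b) (A a c) (A a d) (A a e) (A b c) (A b d) (A b e)
    (A c d) (A c e) (A d e)

lemma total_add (F F' : EdgeFun) : total A (F + F') = total A F + total A F' := by
  simp only [total, Pi.add_apply, sum_add_distrib]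

variable {A}

lemma total_swap01 (hA : ∀ u v, A u v = A v u) (F : EdgeFun) :
    total A (swap01 F) = total A F := by
  unfold total swap01
  rw [sum_comm]
  exact sum_congr rfl fun a _ => sum_congr rfl fun b _ => by rw [hA b a]

lemma total_swap12 (hA : ∀ u v, A u v = A v u) (F : EdgeFun) :
    total A (swap12 F) = total A F := by
  unfold total swap12
  refine sum_congr rfl fun a _ => ?_
  rw [sum_comm]
  exact sum_congr rfl fun b _ => sum_congr rfl fun c _ => by rw [hA c b]

lemma total_swap23 (hA : ∀ u v, A u v = A v u) (F : EdgeFun) :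
    total A (swap23 F) = total A F := by
  unfold total swap23
  refine sum_congr rfl fun a _ => sum_congr rfl fun b _ => ?_
  rw [sum_comm]
  exact sum_congr rfl fun c _ => sum_congr rfl fun d _ => by rw [hA d c]

lemma total_swap34 (hA : ∀ u v, A u v = A v u) (F : EdgeFun) :
    total A (swap34 F) = total A F := by
  unfold total swap34
  refine sum_congr rfl fun a _ => sum_congr rfl fun b _ => sum_congr rfl fun c _ => ?_
  rw [sum_comm]
  exact sum_congr rfl fun d _ => sum_congr rfl fun e _ => by rw [hA e d]

lemma total_symmetrize (hA : ∀ u v, A u v = A v u) (F : EdgeFun) :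
    total A (symmetrize F) = 120 * total A F := by
  simp only [symmetrize, total_add, total_swap01 hA, total_swap12 hA, total_swap23 hA,
    total_swap34 hA]
  ring

end Total

/-- The product of two copies of `s`, attached to the vertices `3` and `4` over the labelled
vertices `0, 1, 2`, and restricted to the triples `0, 1, 2` with pattern weight `c`. -/
def squareTerm (c s : Bool → Bool → Bool → ℤ) : EdgeFun :=
  fun a01 a02 a03 a04 a12 a13 a14 a23 a24 _ => c a01 a02 a12 * (s a03 a13 a23 * s a04 a14 a24)

/-- For a root `0`, the coefficients of `94 xᵀ Q x - 15 n xᵀ x`, where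
`x u = ∑ w, g (0 ∼ u) (0 ∼ w) (u ∼ w)`. -/
def formTerm (g : Bool → Bool → Bool → ℤ) : EdgeFun :=
  fun a01 a02 a03 a04 a12 a13 a14 _ _ a34 =>
    cond a13 94 0 * (g a01 a02 a12 * (g a01 a04 a14 + g a03 a04 a34)) -
      15 * (g a01 a02 a12 * g a01 a04 a14)

section Nonneg

variable {V : Type*} [Fintype V] {A : V → V → Bool}

lemma total_squareTerm_nonneg (A : V → V → Bool) {c : Bool → Bool → Bool → ℤ}
    (hc : ∀ x y z, 0 ≤ c x y z) (s : Bool → Bool → Bool → ℤ) :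
    0 ≤ total A (squareTerm c s) := by
  unfold total squareTerm
  refine sum_nonneg fun a _ => sum_nonneg fun b _ => sum_nonneg fun u _ => ?_
  simp only [← mul_sum, ← sum_mul]
  exact mul_nonneg (hc _ _ _) (mul_self_nonneg _)

lemma total_formTerm_nonneg
    (hQ : ∀ x : V → ℤ, 15 * Fintype.card V * ∑ u, x u * x u ≤
      ∑ u, ∑ v, cond (A u v) 94 0 * (x u * (x u + x v)))
    (g : Bool → Bool → Bool → ℤ) : 0 ≤ total A (formTerm g) := by
  unfold total formTerm
  refine sum_nonneg fun r _ => ?_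
  let x : V → ℤ := fun u => ∑ w, g (A r u) (A r w) (A u w)
  refine (sub_nonneg.2 (hQ x)).trans_eq ?_
  have hx : 15 * (Fintype.card V : ℤ) * ∑ u, x u * x u = ∑ u, ∑ v : V, 15 * (x u * x u) := by
    simp only [sum_const, card_univ, nsmul_eq_mul, mul_sum]
    exact sum_congr rfl fun u _ => by ring
  rw [hx, ← sum_sub_distrib]
  refine sum_congr rfl fun u _ => ?_
  rw [← sum_sub_distrib, sum_comm]
  refine sum_congr rfl fun v _ => ?_
  simp only [sum_sub_distrib, ← mul_sum, ← sum_mul, sum_add_distrib, x]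

end Nonneg

/-- Coefficients of the first test vector. -/
def firstTest (p q r : Bool) : ℤ :=
  cond p (cond q (cond r 0 26) (cond r 100 42)) (cond q (cond r (-98) 45) (cond r 42 (-38)))

/-- Coefficients of the second test vector. -/
def secondTest (p q r : Bool) : ℤ :=
  cond p (cond q (cond r 0 18) (cond r 100 (-91))) (cond q (cond r 40 (-2)) (cond r (-47) 19))

/-- The indicator of three vertices spanning no edge. -/
def emptyTriple (p q r : Bool) : ℤ := cond (p || q || r) 0 1

/-- The indicator of three vertices spanning only the edge `01`. -/
def edgeTriple (p q r : Bool) : ℤ := cond (p && !q && !r) 1 0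

/-- Weights of the extensions of an empty triple by a vertex. -/
def emptyWeight (p q r : Bool) : ℤ :=
  cond p (cond q (cond r 100 (-51)) (cond r (-51) 33)) (cond q (cond r (-51) 33) (cond r 33 (-16)))

/-- Weights, symmetric in the ends of the edge, of the extensions of a single-edge triple. -/
def edgeWeight (p q r : Bool) : ℤ := cond (p || q) (cond r 100 (-36)) (cond r (-76) 12)

/-- Weights, antisymmetric in the ends of the edge, of the extensions of a single-edge triple. -/
def edgeSkewWeight (p q r : Bool) : ℤ :=
  (cond p 1 0 - cond q 1 0) * cond r 3 (-1)

/-- A positive combination of form terms and square terms whose symmetrization is negative on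
triangle-free graphs. -/
def certificate : EdgeFun := fun a01 a02 a03 a04 a12 a13 a14 a23 a24 a34 =>
  304 * formTerm firstTest a01 a02 a03 a04 a12 a13 a14 a23 a24 a34 +
  50 * formTerm secondTest a01 a02 a03 a04 a12 a13 a14 a23 a24 a34 +
  25380 * squareTerm emptyTriple emptyWeight a01 a02 a03 a04 a12 a13 a14 a23 a24 a34 +
  29798 * squareTerm edgeTriple edgeWeight a01 a02 a03 a04 a12 a13 a14 a23 a24 a34 +
  56024000 * squareTerm edgeTriple edgeSkewWeight a01 a02 a03 a04 a12 a13 a14 a23 a24 a34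

lemma symmetrize_certificate_neg : ∀ a01 a02 a12 : Bool, (a01 && a02 && a12) = false →
    ∀ a03 a13 : Bool, (a01 && a03 && a13) = false →
    ∀ a23 : Bool, (a02 && a03 && a23) = false → (a12 && a13 && a23) = false →
    ∀ a04 a14 : Bool, (a01 && a04 && a14) = false →
    ∀ a24 : Bool, (a02 && a04 && a24) = false → (a12 && a14 && a24) = false →
    ∀ a34 : Bool, (a03 && a04 && a34) = false → (a13 && a14 && a34) = false →
      (a23 && a24 && a34) = false →
    symmetrize certificate a01 a02 a03 a04 a12 a13 a14 a23 a24 a34 < 0 := by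
  decide +kernel

section Main

variable {V : Type*} [Fintype V] {A : V → V → Bool}

lemma total_certificate_neg [Nonempty V] (hA : ∀ u v, A u v = A v u)
    (hT : ∀ u v w, (A u v && A u w && A v w) = false) : total A certificate < 0 := by
  have h : total A (symmetrize certificate) < 0 := by
    unfold total
    refine sum_neg (fun a _ => sum_neg (fun b _ => sum_neg (fun c _ => sum_neg (fun d _ =>
      sum_neg (fun e _ => ?_) univ_nonempty) univ_nonempty) univ_nonempty) univ_nonempty)
      univ_nonempty
    exact symmetrize_certificate_neg _ _ _ (hT a b c) _ _ (hT a b d) _ (hT a c d) (hT b c d)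
      _ _ (hT a b e) _ (hT a c e) (hT b c e) _ (hT a d e) (hT b d e) (hT c d e)
  rw [total_symmetrize hA] at h
  linarith

lemma total_certificate_nonneg
    (hQ : ∀ x : V → ℤ, 15 * Fintype.card V * ∑ u, x u * x u ≤
      ∑ u, ∑ v, cond (A u v) 94 0 * (x u * (x u + x v))) : 0 ≤ total A certificate := by
  have hempty : ∀ x y z, 0 ≤ emptyTriple x y z := by decide
  have hedge : ∀ x y z, 0 ≤ edgeTriple x y z := by decide
  have h₁ := total_formTerm_nonneg hQ firstTest
  have h₂ := total_formTerm_nonneg hQ secondTest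
  have h₃ := total_squareTerm_nonneg A hempty emptyWeight
  have h₄ := total_squareTerm_nonneg A hedge edgeWeight
  have h₅ := total_squareTerm_nonneg A hedge edgeSkewWeight
  have h : total A certificate = 304 * total A (formTerm firstTest) +
      50 * total A (formTerm secondTest) +
      25380 * total A (squareTerm emptyTriple emptyWeight) +
      29798 * total A (squareTerm edgeTriple edgeWeight) +
      56024000 * total A (squareTerm edgeTriple edgeSkewWeight) := by
    simp only [total, certificate, sum_add_distrib, ← mul_sum]
  linarith

end Main

/-- The Rayleigh bound: any lower bound for the eigenvalues bounds the quadratic form. -/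
lemma mul_dotProduct_le_of_le_eigenvalues {n : Type*} [Fintype n] [DecidableEq n]
    {M : Matrix n n ℝ} (hM : M.IsHermitian) {c : ℝ} (hc : ∀ i, c ≤ hM.eigenvalues i)
    (x : n → ℝ) : c * (x ⬝ᵥ x) ≤ x ⬝ᵥ (M *ᵥ x) := by
  have hpos : (M - algebraMap ℝ (Matrix n n ℝ) c).PosSemidef := by
    rw [posSemidef_iff_isHermitian_and_spectrum_nonneg]
    refine ⟨hM.sub ?_, ?_⟩
    · rw [algebraMap_eq_diagonal]
      exact isHermitian_diagonal _
    · rw [← spectrum.sub_singleton_eq, hM.spectrum_real_eq_range_eigenvalues]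
      rintro _ ⟨_, ⟨i, rfl⟩, _, rfl, rfl⟩
      exact sub_nonneg.2 (hc i)
  have h := hpos.dotProduct_mulVec_nonneg x
  rw [star_trivial, sub_mulVec, dotProduct_sub, Algebra.algebraMap_eq_smul_one, smul_mulVec, one_mulVec,
    dotProduct_smul, smul_eq_mul] at h
  linarith

lemma dotProduct_signlessLaplacian_mulVec {V : Type*} [Fintype V] [DecidableEq V]
    (G : SimpleGraph V) [DecidableRel G.Adj] (x : V → ℝ) :
    x ⬝ᵥ ((G.degMatrix ℝ + G.adjMatrix ℝ) *ᵥ x) =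
      ∑ u, ∑ v, if G.Adj u v then x u * (x u + x v) else 0 := by
  simp only [dotProduct]
  refine sum_congr rfl fun u _ => ?_
  rw [add_mulVec, Pi.add_apply, SimpleGraph.degMatrix_mulVec_apply,
    SimpleGraph.adjMatrix_mulVec_apply, ← sum_filter, ← SimpleGraph.neighborFinset_eq_filter,
    ← mul_sum, sum_add_distrib, sum_const, SimpleGraph.card_neighborFinset_eq_degree, nsmul_eq_mul]

end TriangleFreeSignless

open TriangleFreeSignless in
/-- **Main theorem.** If `G` is a triangle-free graph on `n` vertices, then the smallest
eigenvalue of its signless Laplacian matrix `Q = D + A` is at most `(15/94) * n`. -/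
theorem smallest_signless_laplacian_eigenvalue_le
    {V : Type*} [Fintype V] [DecidableEq V] [Nonempty V]
    (G : SimpleGraph V) [DecidableRel G.Adj]
    (hG : G.CliqueFree 3)
    (hQ : (G.degMatrix ℝ + G.adjMatrix ℝ).IsHermitian) :
    (⨅ i, hQ.eigenvalues i) ≤ (15 / 94) * (Fintype.card V : ℝ) := by
  by_contra! hlt
  have hle : ∀ i, (15 / 94) * (Fintype.card V : ℝ) ≤ hQ.eigenvalues i := fun i =>
    hlt.le.trans (ciInf_le (Set.finite_range _).bddBelow i)
  have hneg : total (fun u v => decide (G.Adj u v)) certificate < 0 := by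
    refine total_certificate_neg (fun u v => by simp only [G.adj_comm]) fun u v w => ?_
    by_contra h
    simp only [Bool.not_eq_false, Bool.and_eq_true, decide_eq_true_eq] at h
    exact hG _ (SimpleGraph.is3Clique_triple_iff.2 ⟨h.1.1, h.1.2, h.2⟩)
  refine hneg.not_ge (total_certificate_nonneg fun x => ?_)
  have h := mul_dotProduct_le_of_le_eigenvalues hQ hle (fun u => (x u : ℝ))
  rw [dotProduct_signlessLaplacian_mulVec] at h
  have hform : (∑ u, ∑ v, cond (decide (G.Adj u v)) 94 0 * ((x u : ℝ) * (x u + x v))) =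
      94 * ∑ u, ∑ v, if G.Adj u v then (x u : ℝ) * (x u + x v) else 0 := by
    simp only [mul_sum]
    refine sum_congr rfl fun u _ => sum_congr rfl fun v _ => ?_
    by_cases huv : G.Adj u v <;> simp [huv]
  have hreal : 15 * (Fintype.card V : ℝ) * ∑ u, (x u : ℝ) * x u ≤
      ∑ u, ∑ v, cond (decide (G.Adj u v)) 94 0 * ((x u : ℝ) * (x u + x v)) := by
    rw [hform]
    simp only [dotProduct] at h
    linarith
  have hcast : ∀ b : Bool, ((cond b 94 0 : ℤ) : ℝ) = cond b 94 0 := by rintro (_ | _) <;> simp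
  rw [← Int.cast_le (R := ℝ)]
  push_cast [hcast]
  exact hreal
end

section
/- Let G be a d-regular triangle-free simple graph on n vertices. Then λ_1(G) + λ_n(G) ≤ (15/94)·n < (4/25)·n, where λ_1(G) and λ_n(G) denote the largest and smallest eigenvalues of the adjacency matrix of G. (In particular, Brandt's conjecture that λ_1(G) + λ_n(G) ≤ (4/25)·n for regular triangle-free graphs holds.) -/
namespace RegularTriangleFree

variable {V : Type*} [Fintype V]

lemma sum_swap_right (F : V → V → V → ℝ) :
    ∑ u, ∑ v, ∑ w, F u w v = ∑ u, ∑ v, ∑ w, F u v w :=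
  Finset.sum_congr rfl fun _ _ => Finset.sum_comm

lemma sum_rotate (F : V → V → V → ℝ) :
    ∑ u, ∑ v, ∑ w, F v w u = ∑ u, ∑ v, ∑ w, F u v w := by
  rw [Finset.sum_comm]
  exact Finset.sum_congr rfl fun _ _ => Finset.sum_comm

lemma sum_mul_left₃ (c : ℝ) (F : V → V → V → ℝ) :
    ∑ u, ∑ v, ∑ w, c * F u v w = c * ∑ u, ∑ v, ∑ w, F u v w := by
  simp only [Finset.mul_sum]

lemma sum_comm₄ (F : V → V → V → V → ℝ) :
    ∑ u, ∑ v, ∑ w, ∑ x, F u v w x = ∑ x, ∑ u, ∑ v, ∑ w, F u v w x := by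
  calc ∑ u, ∑ v, ∑ w, ∑ x, F u v w x = ∑ u, ∑ v, ∑ x, ∑ w, F u v w x :=
        Finset.sum_congr rfl fun _ _ => Finset.sum_congr rfl fun _ _ => Finset.sum_comm
    _ = ∑ u, ∑ x, ∑ v, ∑ w, F u v w x := Finset.sum_congr rfl fun _ _ => Finset.sum_comm
    _ = ∑ x, ∑ u, ∑ v, ∑ w, F u v w x := Finset.sum_comm

/-- The number of common neighbours of `u` and `v` in the graph with adjacency matrix `a`. -/
def codeg (a : V → V → ℝ) (u v : V) : ℝ := ∑ x, a u x * a v x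

/-- The number of common neighbours of `u`, `v` and `w`. -/
def codeg₃ (a : V → V → ℝ) (u v w : V) : ℝ := ∑ x, a u x * a v x * a w x

/-- `a` is the adjacency matrix of a `d`-regular triangle-free graph. -/
structure IsRegTriFree (a : V → V → ℝ) (d : ℝ) : Prop where
  zero_or_one : ∀ u v, a u v = 0 ∨ a u v = 1
  symm : ∀ u v, a u v = a v u
  triangle : ∀ u v w, a u v * a u w * a v w = 0
  sum_eq : ∀ u, ∑ v, a u v = d

namespace IsRegTriFree

variable {a : V → V → ℝ} {d : ℝ}

lemma sum_eq' (h : IsRegTriFree a d) (v : V) : ∑ u, a u v = d := by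
  rw [← h.sum_eq v]; exact Finset.sum_congr rfl fun u _ => h.symm u v

lemma codeg_comm (a : V → V → ℝ) (u v : V) : codeg a u v = codeg a v u :=
  Finset.sum_congr rfl fun _ _ => mul_comm _ _

lemma adj_mul_codeg (h : IsRegTriFree a d) (u v : V) : a u v * codeg a u v = 0 := by
  rw [codeg, Finset.mul_sum]
  exact Finset.sum_eq_zero fun x _ => by rw [← mul_assoc]; exact h.triangle u v x

lemma adj_mul_codeg₃ (h : IsRegTriFree a d) (u v w : V) : a u v * codeg₃ a u v w = 0 := by
  rw [codeg₃, Finset.mul_sum]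
  exact Finset.sum_eq_zero fun x _ => by linear_combination a w x * h.triangle u v x

lemma adj_mul_codeg₃' (h : IsRegTriFree a d) (u v w : V) : a u w * codeg₃ a u v w = 0 := by
  rw [codeg₃, Finset.mul_sum]
  exact Finset.sum_eq_zero fun x _ => by linear_combination a v x * h.triangle u w x

lemma adj_mul_codeg₃'' (h : IsRegTriFree a d) (u v w : V) : a v w * codeg₃ a u v w = 0 := by
  rw [codeg₃, Finset.mul_sum]
  exact Finset.sum_eq_zero fun x _ => by linear_combination a u x * h.triangle v w x

lemma sum_codeg (h : IsRegTriFree a d) (u : V) : ∑ v, codeg a u v = d * d := by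
  simp only [codeg]
  rw [Finset.sum_comm]
  simp only [← Finset.mul_sum, h.sum_eq', ← Finset.sum_mul, h.sum_eq]

lemma sum_codeg₃ (h : IsRegTriFree a d) (u v : V) : ∑ w, codeg₃ a u v w = d * codeg a u v := by
  simp only [codeg₃, codeg]
  rw [Finset.sum_comm]
  simp only [← Finset.mul_sum, h.sum_eq', ← Finset.sum_mul, mul_comm d]

/-- Number of homomorphisms from the 4-cycle. -/
def c4 (a : V → V → ℝ) : ℝ := ∑ u, ∑ v, codeg a u v ^ 2

/-- Number of homomorphisms from the 5-cycle. -/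
def c5 (a : V → V → ℝ) : ℝ := ∑ u, ∑ v, ∑ w, a v w * (codeg a u v * codeg a u w)

/-- Number of homomorphisms from `K_{2,3}`. -/
def k23 (a : V → V → ℝ) : ℝ := ∑ u, ∑ v, codeg a u v ^ 3

lemma sum_codeg₃_sq (h : IsRegTriFree a d) :
    ∑ u, ∑ v, ∑ w, codeg₃ a u v w ^ 2 = k23 a := by
  have key : ∀ x y : V, codeg a x y ^ 3 =
      ∑ u, ∑ v, ∑ w, (a u x * a v x * a w x) * (a u y * a v y * a w y) := by
    intro x y
    simp only [codeg, pow_three, Finset.sum_mul_sum]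
    refine Finset.sum_congr rfl fun u _ => Finset.sum_congr rfl fun v _ => ?_
    rw [Finset.mul_sum]
    refine Finset.sum_congr rfl fun w _ => ?_
    rw [h.symm x u, h.symm y u, h.symm x v, h.symm y v, h.symm x w, h.symm y w]
    ring
  simp only [k23, key, codeg₃, pow_two, Finset.sum_mul_sum]
  rw [sum_comm₄]
  exact Finset.sum_congr rfl fun x _ => sum_comm₄ _

/-- Pairs `u`, `v` weighted by `f u v`, summed over the vertices adjacent to neither. -/
lemma sum_weight (h : IsRegTriFree a d) (f : V → V → ℝ) :
    ∑ u, ∑ v, ∑ w, f u v * (1 - a u w - a v w + a u w * a v w) =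
      ∑ u, ∑ v, f u v * (Fintype.card V - 2 * d + codeg a u v) := by
  refine Finset.sum_congr rfl fun u _ => Finset.sum_congr rfl fun v _ => ?_
  rw [← Finset.mul_sum]
  simp only [Finset.sum_add_distrib, Finset.sum_sub_distrib, h.sum_eq, codeg]
  simp only [Finset.sum_const, Finset.card_univ, nsmul_eq_mul, mul_one]
  ring

lemma codeg₃_swap_right (a : V → V → ℝ) (u v w : V) : codeg₃ a u w v = codeg₃ a u v w :=
  Finset.sum_congr rfl fun _ _ => by ring

lemma codeg₃_rotate (a : V → V → ℝ) (u v w : V) : codeg₃ a v w u = codeg₃ a u v w :=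
  Finset.sum_congr rfl fun _ _ => by ring

lemma independent_triple_identity {x y z k₁ k₂ k₃ t : ℝ} (hx : x = 0 ∨ x = 1)
    (hy : y = 0 ∨ y = 1) (hz : z = 0 ∨ z = 1) (hxyz : x * y * z = 0) (h₁ : x * k₁ = 0)
    (h₂ : y * k₂ = 0) (h₃ : z * k₃ = 0) (hxt : x * t = 0) (hyt : y * t = 0) (hzt : z * t = 0)
    (s r : ℝ) :
    (1 - x) * (1 - y) * (1 - z) * (t - s * (k₁ + k₂ + k₃) + r) ^ 2 =
      t ^ 2 + 2 * r * t + r ^ 2 * ((1 - x) * (1 - y - z + y * z)) +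
      ((s ^ 2 * k₁ ^ 2 - 2 * r * s * k₁) * (1 - y - z + y * z) +
          2 * s ^ 2 * (k₂ * k₃ * (1 - x)) - 2 * s * (t * k₁) +
        ((s ^ 2 * k₂ ^ 2 - 2 * r * s * k₂) * (1 - x - z + x * z) +
          2 * s ^ 2 * (k₁ * k₃ * (1 - y)) - 2 * s * (t * k₂)) +
        ((s ^ 2 * k₃ ^ 2 - 2 * r * s * k₃) * (1 - x - y + x * y) +
          2 * s ^ 2 * (k₁ * k₂ * (1 - z)) - 2 * s * (t * k₃))) := by
  rcases hx with rfl | rfl <;> rcases hy with rfl | rfl <;> rcases hz with rfl | rfl <;>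
    simp only [one_mul, zero_mul, mul_one, one_ne_zero] at * <;> subst_vars <;> ring

lemma edge_vertex_identity {x y z k₁ k₂ : ℝ} (hx : x = 0 ∨ x = 1)
    (hy : y = 0 ∨ y = 1) (hz : z = 0 ∨ z = 1) (hxyz : x * y * z = 0) (h₁ : x * k₁ = 0)
    (h₂ : y * k₂ = 0) (α β t : ℝ) :
    z * (1 - x) * (1 - y) * (α * (k₁ + k₂ - t) ^ 2 + β * (k₁ - k₂) ^ 2) =
      ((α + β) * k₁ ^ 2 - 2 * α * t * k₁) * (z - y * z) +
        ((α + β) * k₂ ^ 2 - 2 * α * t * k₂) * (z - x * z) +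
        2 * (α - β) * (z * (k₁ * k₂)) + α * t ^ 2 * (z * (1 - x - y)) := by
  rcases hx with rfl | rfl <;> rcases hy with rfl | rfl <;> rcases hz with rfl | rfl <;>
    simp only [one_mul, zero_mul, mul_one, one_ne_zero] at * <;> subst_vars <;> ring

/-- Summing `(codeg₃ - s (codeg + codeg + codeg) + r) ^ 2` over independent triples. -/
lemma independent_triple_ineq (h : IsRegTriFree a d) (s r n : ℝ) (hn : n = Fintype.card V) :
    0 ≤ k23 a + s ^ 2 * (3 * ((n - 2 * d) * c4 a + k23 a) + 6 * (n * d ^ 4 - c5 a)) +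
      r ^ 2 * (n ^ 3 - 3 * n ^ 2 * d + 3 * n * d ^ 2) + 2 * r * n * d ^ 3 - 6 * s * d * c4 a -
      6 * s * r * ((n - 2 * d) * (n * d ^ 2) + c4 a) := by
  subst hn
  set N : ℝ := (Fintype.card V : ℝ)
  set T := codeg₃ a with hT
  set k := codeg a with hk
  set M : V → V → V → ℝ := fun u v w =>
    (s ^ 2 * k u v ^ 2 - 2 * r * s * k u v) * (1 - a u w - a v w + a u w * a v w) +
      2 * s ^ 2 * (k w u * k w v * (1 - a u v)) - 2 * s * (T u v w * k u v) with hM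
  have hpt : ∀ u v w, 0 ≤ T u v w ^ 2 + 2 * r * T u v w +
      r ^ 2 * ((1 - a u v) * (1 - a u w - a v w + a u w * a v w)) +
      (M u v w + M u w v + M v w u) := by
    intro u v w
    suffices 0 ≤ (1 - a u v) * (1 - a u w) * (1 - a v w) *
        (T u v w - s * (k u v + k u w + k v w) + r) ^ 2 by
      refine this.trans_eq ?_
      simp only [hM, hT, codeg₃_swap_right a u v w, codeg₃_rotate a u v w]
      rw [← hT, hk, codeg_comm a w u, codeg_comm a w v, codeg_comm a v u, ← hk,
        h.symm w v, h.symm w u, h.symm v u]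
      exact independent_triple_identity (h.zero_or_one u v) (h.zero_or_one u w)
        (h.zero_or_one v w) (h.triangle u v w) (h.adj_mul_codeg u v) (h.adj_mul_codeg u w)
        (h.adj_mul_codeg v w) (h.adj_mul_codeg₃ u v w) (h.adj_mul_codeg₃' u v w)
        (h.adj_mul_codeg₃'' u v w) s r
    have h0 : ∀ x y, 0 ≤ 1 - a x y := fun x y => by
      rcases h.zero_or_one x y with e | e <;> rw [e] <;> norm_num
    have := h0 u v
    have := h0 u w
    have := h0 v w
    positivity
  have hsumT : ∑ u, ∑ v, ∑ w, T u v w = N * d ^ 3 := by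
    simp only [hT, h.sum_codeg₃, ← Finset.mul_sum, h.sum_codeg]
    simp only [Finset.sum_const, Finset.card_univ, nsmul_eq_mul]
    ring
  have hsumTk : ∑ u, ∑ v, ∑ w, T u v w * k u v = d * c4 a := by
    simp only [hT, hk, ← Finset.sum_mul, h.sum_codeg₃, c4, Finset.mul_sum]
    exact Finset.sum_congr rfl fun _ _ => Finset.sum_congr rfl fun _ _ => by ring
  have hsumk : ∑ u, ∑ v, k u v = N * d ^ 2 := by
    simp only [hk, h.sum_codeg, Finset.sum_const, Finset.card_univ, nsmul_eq_mul]
    ring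
  have hI : ∑ u, ∑ v, ∑ w, (1 - a u v) * (1 - a u w - a v w + a u w * a v w) =
      N ^ 3 - 3 * N ^ 2 * d + 3 * N * d ^ 2 := by
    have e : ∀ u v, (1 - a u v) * (Fintype.card V - 2 * d + codeg a u v) =
        (N - 2 * d) - (N - 2 * d) * a u v + k u v := fun u v => by
      rw [hk]; linear_combination - h.adj_mul_codeg u v
    rw [h.sum_weight fun u v => 1 - a u v]
    simp only [e, Finset.sum_add_distrib, Finset.sum_sub_distrib, ← Finset.mul_sum, hsumk,
      h.sum_eq, Finset.sum_const, Finset.card_univ, nsmul_eq_mul]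
    ring
  have hH : ∑ u, ∑ v, ∑ w, k w u * k w v * (1 - a u v) = N * d ^ 4 - c5 a := by
    rw [← sum_rotate]
    have e : ∀ u v w, k u v * k u w * (1 - a v w) =
        k u v * k u w - a v w * (k u v * k u w) := fun u v w => by ring
    simp only [e, Finset.sum_sub_distrib, c5]
    simp only [hk, ← Finset.mul_sum, h.sum_codeg]
    simp only [← Finset.sum_mul, h.sum_codeg, Finset.sum_const, Finset.card_univ, nsmul_eq_mul]
    ring
  have hW : ∑ u, ∑ v, ∑ w, (s ^ 2 * k u v ^ 2 - 2 * r * s * k u v) *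
      (1 - a u w - a v w + a u w * a v w) =
      s ^ 2 * ((N - 2 * d) * c4 a + k23 a) -
        2 * r * s * ((N - 2 * d) * (N * d ^ 2) + c4 a) := by
    rw [h.sum_weight fun u v => s ^ 2 * k u v ^ 2 - 2 * r * s * k u v, ← hsumk]
    simp only [c4, k23, Finset.mul_sum, ← Finset.sum_add_distrib, ← Finset.sum_sub_distrib]
    exact Finset.sum_congr rfl fun _ _ => Finset.sum_congr rfl fun _ _ => by rw [← hk]; ring
  have hsumM : ∑ u, ∑ v, ∑ w, M u v w = s ^ 2 * ((N - 2 * d) * c4 a + k23 a) -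
      2 * r * s * ((N - 2 * d) * (N * d ^ 2) + c4 a) + 2 * s ^ 2 * (N * d ^ 4 - c5 a) -
      2 * s * (d * c4 a) := by
    simp only [hM, Finset.sum_add_distrib, Finset.sum_sub_distrib]
    rw [hW, sum_mul_left₃, sum_mul_left₃, hH, hsumTk]
  have hpos := Finset.sum_nonneg fun u (_ : u ∈ Finset.univ) =>
    Finset.sum_nonneg fun v (_ : v ∈ Finset.univ) =>
      Finset.sum_nonneg fun w (_ : w ∈ Finset.univ) => hpt u v w
  simp only [Finset.sum_add_distrib, sum_mul_left₃] at hpos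
  rw [hI, hsumT, sum_swap_right M, sum_rotate M, hsumM, hT, h.sum_codeg₃_sq] at hpos
  linarith

lemma sum_edge_nonadj (h : IsRegTriFree a d) :
    ∑ u, ∑ v, ∑ w, a v w * (1 - a u v - a u w) =
      (Fintype.card V : ℝ) ^ 2 * d - 2 * Fintype.card V * d ^ 2 := by
  have e : ∀ u v w, a v w * (1 - a u v - a u w) = a v w - a u v * a v w - a u w * a w v :=
    fun u v w => by rw [h.symm w v]; ring
  simp only [e, Finset.sum_sub_distrib]
  rw [sum_swap_right fun u v w => a u v * a v w]
  simp only [← Finset.mul_sum, h.sum_eq, ← Finset.sum_mul, Finset.sum_const, Finset.card_univ,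
    nsmul_eq_mul]
  ring

lemma two_mul_le_card [Nonempty V] (h : IsRegTriFree a d) (hd : 0 < d) :
    2 * d ≤ Fintype.card V := by
  have hn : (0 : ℝ) < Fintype.card V := by exact_mod_cast Fintype.card_pos
  have hpos : 0 ≤ ∑ u, ∑ v, ∑ w, a v w * (1 - a u v - a u w) := by
    refine Finset.sum_nonneg fun u _ => Finset.sum_nonneg fun v _ => Finset.sum_nonneg fun w _ => ?_
    have := h.triangle u v w
    rcases h.zero_or_one u v with e1 | e1 <;> rcases h.zero_or_one u w with e2 | e2 <;>
      rcases h.zero_or_one v w with e3 | e3 <;> revert this <;>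
      rw [e1, e2, e3] <;> norm_num
  rw [h.sum_edge_nonadj] at hpos
  have : 0 ≤ (Fintype.card V * d) * (Fintype.card V - 2 * d) := by linarith
  linarith [nonneg_of_mul_nonneg_right this (by positivity)]

/-- Summing `α (codeg u v + codeg u w - t) ^ 2 + β (codeg u v - codeg u w) ^ 2` over edges `v w`
and vertices `u` adjacent to neither end. -/
lemma edge_vertex_ineq (h : IsRegTriFree a d) (α β t n : ℝ) (hα : 0 ≤ α) (hβ : 0 ≤ β)
    (hn : n = Fintype.card V) :
    0 ≤ 2 * (α + β) * (d * c4 a - k23 a) + 2 * (α - β) * c5 a -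
      4 * α * t * (n * d ^ 3 - c4 a) + α * t ^ 2 * (n ^ 2 * d - 2 * n * d ^ 2) := by
  subst hn
  set N : ℝ := (Fintype.card V : ℝ)
  set k := codeg a with hk
  set P : V → V → V → ℝ := fun u v w =>
    ((α + β) * k u v ^ 2 - 2 * α * t * k u v) * (a v w - a u w * a v w) with hP
  have hpt : ∀ u v w, 0 ≤ P u v w + P u w v + 2 * (α - β) * (a v w * (k u v * k u w)) +
      α * t ^ 2 * (a v w * (1 - a u v - a u w)) := by
    intro u v w
    suffices 0 ≤ a v w * (1 - a u v) * (1 - a u w) *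
        (α * (k u v + k u w - t) ^ 2 + β * (k u v - k u w) ^ 2) by
      refine this.trans_eq ?_
      simp only [hP]
      rw [h.symm w v]
      exact edge_vertex_identity (h.zero_or_one u v) (h.zero_or_one u w)
        (h.zero_or_one v w) (h.triangle u v w) (h.adj_mul_codeg u v) (h.adj_mul_codeg u w) α β t
    have h0 : ∀ x y, 0 ≤ 1 - a x y := fun x y => by
      rcases h.zero_or_one x y with e | e <;> rw [e] <;> norm_num
    have := h0 u v
    have := h0 u w
    have : 0 ≤ a v w := by rcases h.zero_or_one v w with e | e <;> rw [e]; norm_num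
    positivity
  have hsumk : ∑ u, ∑ v, k u v = N * d ^ 2 := by
    simp only [hk, h.sum_codeg, Finset.sum_const, Finset.card_univ, nsmul_eq_mul]
    ring
  have hsumP : ∑ u, ∑ v, ∑ w, P u v w = (α + β) * (d * c4 a - k23 a) -
      2 * α * t * (N * d ^ 3 - c4 a) := by
    have e : ∀ u v, ∑ w, P u v w =
        ((α + β) * k u v ^ 2 - 2 * α * t * k u v) * (d - k u v) := fun u v => by
      simp only [hP, ← Finset.mul_sum, Finset.sum_sub_distrib, h.sum_eq, hk, codeg]
    simp only [e]
    rw [show N * d ^ 3 = d * (N * d ^ 2) by ring, ← hsumk]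
    simp only [c4, k23, Finset.mul_sum, ← Finset.sum_sub_distrib]
    exact Finset.sum_congr rfl fun _ _ => Finset.sum_congr rfl fun _ _ => by rw [← hk]; ring
  have hpos := Finset.sum_nonneg fun u (_ : u ∈ Finset.univ) =>
    Finset.sum_nonneg fun v (_ : v ∈ Finset.univ) =>
      Finset.sum_nonneg fun w (_ : w ∈ Finset.univ) => hpt u v w
  simp only [Finset.sum_add_distrib, sum_mul_left₃] at hpos
  rw [h.sum_edge_nonadj, sum_swap_right P, hsumP] at hpos
  simp only [c5]
  linarith

lemma c4_density_lower_bound {δ C K P s r τ α β : ℝ} (h0 : 0 < δ)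
    (hs : s = 23 / 20 * δ) (hr : r = 13 / 20 * δ ^ 2) (hτ : τ = 5 / 2 * δ ^ 2)
    (hα : α = (1 + 9 * s ^ 2) / 4) (hβ : β = (1 - 3 * s ^ 2) / 4)
    (H1 : 0 ≤ K + s ^ 2 * (3 * ((1 - 2 * δ) * C + K) + 6 * (δ ^ 4 - P)) +
      r ^ 2 * (1 - 3 * δ + 3 * δ ^ 2) + 2 * r * δ ^ 3 - 6 * s * δ * C -
      6 * s * r * ((1 - 2 * δ) * δ ^ 2 + C))
    (H2 : 0 ≤ 2 * (α + β) * (δ * C - K) + 2 * (α - β) * P - 4 * α * τ * (δ ^ 3 - C) +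
      α * τ ^ 2 * (δ - 2 * δ ^ 2)) :
    δ ^ 3 - 15 / 94 * δ ^ 2 ≤ C := by
  subst hα hβ hs hr hτ
  have hA : 0 < 1 - 173 / 400 * δ - 3381 / 400 * δ ^ 2 + 4761 / 160 * δ ^ 3 := by
    nlinarith [mul_nonneg h0.le (sq_nonneg (δ - 1 / 5)), sq_nonneg (δ - 1 / 5)]
  have hg : 0 < 15 / 94 - 56081 / 37600 * δ + 168211 / 37600 * δ ^ 2 - 138869 / 75200 * δ ^ 3 -
      4761 / 256 * δ ^ 4 + 4761 / 128 * δ ^ 5 := by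
    have hQ : 0 < 2.3568 - 3.9743 * δ + 0.74390625 * δ ^ 2 + 4761 / 128 * δ ^ 3 := by
      nlinarith [mul_nonneg h0.le (sq_nonneg (δ - 1 / 5)), sq_nonneg (δ - 1 / 5)]
    nlinarith [mul_nonneg (sq_nonneg (δ - 13 / 50)) hQ.le, mul_pos h0 h0, pow_pos h0 3]
  have key : 0 ≤ δ * (1 - 173 / 400 * δ - 3381 / 400 * δ ^ 2 + 4761 / 160 * δ ^ 3) *
      (C - (δ ^ 3 - 15 / 94 * δ ^ 2)) := by
    linarith [mul_pos (pow_pos h0 3) hg]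
  linarith [nonneg_of_mul_nonneg_right key (mul_pos h0 hA)]

lemma c4_lower_bound [Nonempty V] (h : IsRegTriFree a d) (n : ℝ) (hn : n = Fintype.card V)
    (hd : 0 ≤ d) : n * d ^ 3 - 15 / 94 * n ^ 2 * d ^ 2 ≤ c4 a := by
  have hn0 : 0 < n := by rw [hn]; exact_mod_cast Fintype.card_pos
  rcases hd.eq_or_lt with rfl | hd
  · have : 0 ≤ c4 a := Finset.sum_nonneg fun u _ => Finset.sum_nonneg fun v _ => sq_nonneg _
    linarith
  have hdn : d / n ≤ 1 / 2 := by
    rw [div_le_iff₀ hn0, hn]; linarith [h.two_mul_le_card hd]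
  have hδ : 0 < d / n := by positivity
  obtain ⟨δ, hδ'⟩ : ∃ δ, δ = d / n := ⟨_, rfl⟩
  rw [← hδ'] at hdn hδ
  obtain rfl : d = δ * n := by rw [hδ']; field_simp
  have hβ : 0 ≤ (1 - 3 * (23 / 20 * δ) ^ 2) / 4 := by nlinarith
  have H1 := h.independent_triple_ineq (23 / 20 * δ) (13 / 20 * δ ^ 2 * n) n hn
  have H2 := h.edge_vertex_ineq ((1 + 9 * (23 / 20 * δ) ^ 2) / 4) _ (5 / 2 * δ ^ 2 * n) n
    (by positivity) hβ hn
  have hc := c4_density_lower_bound (C := c4 a / n ^ 4) (K := k23 a / n ^ 5) (P := c5 a / n ^ 5)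
    hδ rfl rfl rfl rfl rfl
    (by refine (div_nonneg H1 (pow_nonneg hn0.le 5)).trans_eq ?_; field_simp)
    (by refine (div_nonneg H2 (pow_nonneg hn0.le 5)).trans_eq ?_; field_simp)
  rw [le_div_iff₀ (by positivity)] at hc
  linarith

/-- A lower bound `μ` for the Rayleigh quotients of `a` satisfies `μ * (n * d ^ 2) ≤ -c4 a`: test it
on the differences of the neighbourhoods of adjacent vertices. -/
lemma rayleigh_neighborhood_le (h : IsRegTriFree a d) {μ : ℝ}
    (hμ : ∀ x : V → ℝ, μ * ∑ i, x i ^ 2 ≤ ∑ i, x i * ∑ j, a i j * x j) :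
    μ * (Fintype.card V * d ^ 2) ≤ -c4 a := by
  have hnn : ∀ u v, 0 ≤ a u v := fun u v => by
    rcases h.zero_or_one u v with e | e <;> rw [e]; norm_num
  have hmul : ∀ u v, ∑ j, a u j * a v j = codeg a u v := fun _ _ => rfl
  have hsq : ∀ u v, ∑ i, (a u i - a v i) ^ 2 = 2 * d - 2 * codeg a u v := fun u v => by
    have e : ∀ i, (a u i - a v i) ^ 2 = a u i + a v i - 2 * (a u i * a v i) := fun i => by
      rcases h.zero_or_one u i with e | e <;> rcases h.zero_or_one v i with e' | e' <;>
        rw [e, e'] <;> norm_num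
    simp only [e, Finset.sum_sub_distrib, Finset.sum_add_distrib, ← Finset.mul_sum, h.sum_eq, hmul]
    ring
  have hform : ∀ u v, ∑ i, (a u i - a v i) * ∑ j, a i j * (a u j - a v j) =
      -∑ i, (a u i * codeg a i v + a v i * codeg a i u) := fun u v => by
    rw [← Finset.sum_neg_distrib]
    refine Finset.sum_congr rfl fun i _ => ?_
    have e : ∑ j, a i j * (a u j - a v j) = codeg a i u - codeg a i v := by
      simp only [codeg, mul_sub, Finset.sum_sub_distrib]
    have h1 := h.adj_mul_codeg i u
    have h2 := h.adj_mul_codeg i v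
    rw [e, h.symm u i, h.symm v i]
    linear_combination h1 + h2
  have hpt : ∀ u v, 0 ≤ -(∑ i, (a u v * a u i * codeg a i v + a v u * a v i * codeg a i u)) -
      μ * (2 * d * a u v) := fun u v => by
    have := mul_nonneg (hnn u v) (sub_nonneg.2 (hμ fun i => a u i - a v i))
    rw [hsq, hform] at this
    refine this.trans_eq ?_
    have e : ∑ i, (a u v * a u i * codeg a i v + a v u * a v i * codeg a i u) =
        a u v * ∑ i, (a u i * codeg a i v + a v i * codeg a i u) := by
      rw [Finset.mul_sum, h.symm v u]
      exact Finset.sum_congr rfl fun i _ => by ring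
    rw [e]
    linear_combination (2 * μ) * h.adj_mul_codeg u v
  have hc : ∑ u, ∑ v, ∑ i, a u v * a u i * codeg a i v = c4 a := by
    rw [c4, Finset.sum_comm]
    refine Finset.sum_congr rfl fun v _ => ?_
    rw [Finset.sum_comm]
    refine Finset.sum_congr rfl fun i _ => ?_
    rw [← Finset.sum_mul, codeg_comm a i v, pow_two]
    congr 1
    exact Finset.sum_congr rfl fun u _ => by rw [h.symm u v, h.symm u i]
  have hc' : ∑ u, ∑ v, ∑ i, a v u * a v i * codeg a i u = c4 a := by
    rw [Finset.sum_comm, hc]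
  have hpos := Finset.sum_nonneg fun u (_ : u ∈ Finset.univ) =>
    Finset.sum_nonneg fun v (_ : v ∈ Finset.univ) => hpt u v
  simp only [Finset.sum_sub_distrib, Finset.sum_neg_distrib, Finset.sum_add_distrib,
    ← Finset.mul_sum, h.sum_eq] at hpos
  rw [hc, hc'] at hpos
  simp only [Finset.sum_const, Finset.card_univ, nsmul_eq_mul] at hpos
  linarith

/-- The quadratic form of a `d`-regular graph is at most `d` times the squared norm. -/
lemma sum_mul_sum_le (h : IsRegTriFree a d) (x : V → ℝ) :
    ∑ i, x i * ∑ j, a i j * x j ≤ d * ∑ i, x i ^ 2 := by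
  have h1 : ∑ i, ∑ j, a i j * x i ^ 2 = d * ∑ i, x i ^ 2 := by
    simp only [← Finset.sum_mul, h.sum_eq, Finset.mul_sum]
  have h2 : ∑ i, ∑ j, a i j * x j ^ 2 = d * ∑ i, x i ^ 2 := by
    rw [Finset.sum_comm]
    simp only [← Finset.sum_mul, h.sum_eq', Finset.mul_sum]
  have h3 : ∀ i j, 0 ≤ a i j * x i ^ 2 + a i j * x j ^ 2 - 2 * (x i * (a i j * x j)) := by
    intro i j
    rcases h.zero_or_one i j with e | e <;> rw [e]
    · simp
    · linarith [sq_nonneg (x i - x j)]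
  have hpos := Finset.sum_nonneg fun u (_ : u ∈ Finset.univ) =>
    Finset.sum_nonneg fun v (_ : v ∈ Finset.univ) => h3 u v
  simp only [Finset.sum_sub_distrib, Finset.sum_add_distrib, ← Finset.mul_sum, h1, h2] at hpos
  linarith

end IsRegTriFree

lemma isRegTriFree_adjMatrix (G : SimpleGraph V) [DecidableRel G.Adj] {d : ℕ}
    (hreg : G.IsRegularOfDegree d) (hG : G.CliqueFree 3) :
    IsRegTriFree (G.adjMatrix ℝ) d where
  zero_or_one u v := by
    rw [SimpleGraph.adjMatrix_apply]; split_ifs <;> simp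
  symm u v := by simp only [SimpleGraph.adjMatrix_apply, G.adj_comm]
  triangle u v w := by
    classical
    simp only [SimpleGraph.adjMatrix_apply]
    by_contra hne
    have h1 : G.Adj u v := by by_contra h; simp [h] at hne
    have h2 : G.Adj u w := by by_contra h; simp [h] at hne
    have h3 : G.Adj v w := by by_contra h; simp [h] at hne
    exact hG {u, v, w} (SimpleGraph.is3Clique_triple_iff.2 ⟨h1, h2, h3⟩)
  sum_eq u := by
    rw [← hreg u, ← SimpleGraph.card_neighborFinset_eq_degree, SimpleGraph.neighborFinset_eq_filter]
    simp [SimpleGraph.adjMatrix_apply]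

section Eigenvalues

variable [DecidableEq V] {A : Matrix V V ℝ}

lemma eigenvalues_le (hA : A.IsHermitian) {c : ℝ}
    (hc : ∀ x : V → ℝ, ∑ i, x i * ∑ j, A i j * x j ≤ c * ∑ i, x i ^ 2) (i : V) :
    hA.eigenvalues i ≤ c := by
  set x : V → ℝ := ⇑(hA.eigenvectorBasis i) with hx
  have hev : ∀ k, ∑ j, A k j * x j = hA.eigenvalues i * x k :=
    fun k => congrFun (hA.mulVec_eigenvectorBasis i) k
  have hnorm : ∑ k, x k ^ 2 = 1 := by
    have := EuclideanSpace.real_norm_sq_eq (hA.eigenvectorBasis i)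
    rw [hA.eigenvectorBasis.orthonormal.1 i] at this
    simpa using this.symm
  have := hc x
  simp only [hev, mul_left_comm _ (hA.eigenvalues i), ← Finset.mul_sum, ← pow_two, hnorm] at this
  linarith

lemma le_sum_mul_sum (hA : A.IsHermitian) {c : ℝ} (hc : ∀ i, c ≤ hA.eigenvalues i) (x : V → ℝ) :
    c * ∑ i, x i ^ 2 ≤ ∑ i, x i * ∑ j, A i j * x j := by
  have hB : (A - algebraMap ℝ (Matrix V V ℝ) c).IsHermitian :=
    hA.sub (by simp [Matrix.algebraMap_eq_diagonal])
  have hpsd : (A - algebraMap ℝ (Matrix V V ℝ) c).PosSemidef := by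
    refine hB.posSemidef_iff_eigenvalues_nonneg.2 fun i => ?_
    have hi := hB.eigenvalues_mem_spectrum_real i
    rw [← spectrum.sub_singleton_eq, hA.spectrum_real_eq_range_eigenvalues] at hi
    obtain ⟨_, ⟨j, rfl⟩, b, rfl, hj⟩ := hi
    have : hA.eigenvalues j - b = hB.eigenvalues i := hj
    exact this ▸ sub_nonneg.2 (hc j)
  have := hpsd.dotProduct_mulVec_nonneg x
  simp only [Matrix.sub_mulVec, dotProduct_sub, Algebra.algebraMap_eq_smul_one,
    Matrix.smul_mulVec, Matrix.one_mulVec, dotProduct_smul, star_trivial, smul_eq_mul] at this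
  simp only [pow_two]
  exact sub_nonneg.1 this

end Eigenvalues

end RegularTriangleFree

/-- If `G` is a `d`-regular triangle-free graph on `n` vertices, then the sum of the largest
and the smallest adjacency eigenvalues satisfies
`λ₁(G) + λₙ(G) ≤ (15/94) * n < (4/25) * n` (Brandt's conjecture). -/
theorem regular_triangle_free_extreme_adj_eigenvalues
    {V : Type*} [Fintype V] [DecidableEq V] [Nonempty V]
    (G : SimpleGraph V) [DecidableRel G.Adj] (d : ℕ)
    (hreg : G.IsRegularOfDegree d)
    (hG : G.CliqueFree 3)
    (hA : (G.adjMatrix ℝ).IsHermitian) :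
    (⨆ i, hA.eigenvalues i) + (⨅ i, hA.eigenvalues i) ≤ (15 / 94) * (Fintype.card V : ℝ) ∧
      (15 / 94 : ℝ) * (Fintype.card V : ℝ) < (4 / 25) * (Fintype.card V : ℝ) := by
  have hn : (0 : ℝ) < Fintype.card V := by exact_mod_cast Fintype.card_pos
  refine ⟨?_, by linarith⟩
  have h := RegularTriangleFree.isRegTriFree_adjMatrix G hreg hG
  have hle := RegularTriangleFree.eigenvalues_le hA h.sum_mul_sum_le
  have hsup : (⨆ i, hA.eigenvalues i) ≤ d := ciSup_le hle
  have hinf : ∀ i, (⨅ i, hA.eigenvalues i) ≤ hA.eigenvalues i :=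
    ciInf_le (Set.finite_range _).bddBelow
  have hray := h.rayleigh_neighborhood_le (RegularTriangleFree.le_sum_mul_sum hA hinf)
  have hc4 := h.c4_lower_bound _ rfl d.cast_nonneg
  set μ : ℝ := ⨅ i, hA.eigenvalues i
  rcases d.eq_zero_or_pos with rfl | hd
  · obtain ⟨i⟩ := ‹Nonempty V›
    have := (hinf i).trans (hle i)
    push_cast at this hsup
    linarith
  · have hd' : (0 : ℝ) < d := by exact_mod_cast hd
    have key : 0 ≤ (Fintype.card V * (d : ℝ) ^ 2) * (15 / 94 * Fintype.card V - d - μ) := by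
      linarith
    linarith [nonneg_of_mul_nonneg_right key (by positivity)]
end

section
/- Let G be a triangle-free simple graph on n vertices and let xy be an edge of G. Then (deg(x) + deg(y)) · q_n(G) ≤ w_x + w_y − 2·m_{xy}, where q_n(G) is the smallest eigenvalue of the signless Laplacian matrix of G. -/
/-- `wWalk G x` is the number of walks of length two starting at `x`, i.e. the number of
ordered pairs `(u, v)` of vertices with `xu ∈ E(G)` and `uv ∈ E(G)`. -/
noncomputable def wWalk {V : Type*} (G : SimpleGraph V) (x : V) : ℕ :=
  Nat.card {p : V × V // G.Adj x p.1 ∧ G.Adj p.1 p.2}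

/-- `mCount G x y` is the number of edges `uv ∈ E(G)` (counted with their orientation,
i.e. the number of ordered pairs `(u, v)` with `uv ∈ E(G)`) such that `ux ∈ E(G)` and
`vy ∈ E(G)`. -/
noncomputable def mCount {V : Type*} (G : SimpleGraph V) (x y : V) : ℕ :=
  Nat.card {p : V × V // G.Adj p.1 p.2 ∧ G.Adj p.1 x ∧ G.Adj p.2 y}

open Matrix in
/-- The smallest eigenvalue of a real symmetric matrix bounds its quadratic form from below. -/
theorem Matrix.IsHermitian.iInf_eigenvalues_mul_dotProduct_le {n : Type*} [Fintype n]
    [DecidableEq n] {A : Matrix n n ℝ} (hA : A.IsHermitian) (v : n → ℝ) :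
    (⨅ i, hA.eigenvalues i) * (v ⬝ᵥ v) ≤ v ⬝ᵥ (A *ᵥ v) := by
  set c := ⨅ i, hA.eigenvalues i
  have hB : (A - algebraMap ℝ (Matrix n n ℝ) c).IsHermitian := by
    refine hA.sub ?_
    rw [Algebra.algebraMap_eq_smul_one]
    simp [IsHermitian]
  have hpos : (A - algebraMap ℝ (Matrix n n ℝ) c).PosSemidef := by
    rw [posSemidef_iff_isHermitian_and_spectrum_nonneg]
    refine ⟨hB, ?_⟩
    rw [← spectrum.sub_singleton_eq, hA.spectrum_real_eq_range_eigenvalues]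
    rintro _ ⟨_, ⟨i, rfl⟩, _, rfl, rfl⟩
    exact sub_nonneg.2 (ciInf_le (Set.finite_range hA.eigenvalues).bddBelow i)
  have h := hpos.dotProduct_mulVec_nonneg v
  rw [star_trivial, Algebra.algebraMap_eq_smul_one, sub_mulVec, smul_mulVec, one_mulVec,
    dotProduct_sub, dotProduct_smul, smul_eq_mul] at h
  linarith

theorem natCast_card_subtype_prod {V R : Type*} [Fintype V] [NonAssocSemiring R]
    (P : V × V → Prop) [DecidablePred P] :
    (Nat.card {p : V × V // P p} : R) = ∑ u, ∑ v, if P (u, v) then 1 else 0 := by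
  rw [Nat.card_eq_fintype_card, Fintype.card_subtype, ← Finset.sum_boole, Fintype.sum_prod_type]

theorem natCast_wWalk_eq_sum {V : Type*} [Fintype V] (G : SimpleGraph V) [DecidableRel G.Adj]
    (x : V) : (wWalk G x : ℝ) = ∑ u, ∑ v, G.adjMatrix ℝ x u * G.adjMatrix ℝ u v := by
  rw [wWalk, natCast_card_subtype_prod]
  refine Finset.sum_congr rfl fun u _ => Finset.sum_congr rfl fun v _ => ?_
  simp only [SimpleGraph.adjMatrix_apply, ite_and, ite_mul, one_mul, zero_mul]

theorem natCast_mCount_eq_sum {V : Type*} [Fintype V] (G : SimpleGraph V) [DecidableRel G.Adj]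
    (x y : V) : (mCount G x y : ℝ) =
      ∑ u, ∑ v, G.adjMatrix ℝ u v * (G.adjMatrix ℝ x u * G.adjMatrix ℝ y v) := by
  rw [mCount, natCast_card_subtype_prod]
  refine Finset.sum_congr rfl fun u _ => Finset.sum_congr rfl fun v _ => ?_
  simp only [SimpleGraph.adjMatrix_apply, ite_and, ite_mul, one_mul, zero_mul, G.adj_comm x,
    G.adj_comm y]

open Matrix in
theorem SimpleGraph.dotProduct_degMatrix_add_adjMatrix_mulVec {V : Type*} [Fintype V]
    [DecidableEq V] (G : SimpleGraph V) [DecidableRel G.Adj] (f : V → ℝ) :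
    f ⬝ᵥ ((G.degMatrix ℝ + G.adjMatrix ℝ) *ᵥ f) =
      ∑ u, ∑ v, G.adjMatrix ℝ u v * (f u ^ 2 + f u * f v) := by
  rw [add_mulVec, dotProduct_add, G.dotProduct_mulVec_degMatrix, G.dotProduct_mulVec_adjMatrix,
    ← Finset.sum_add_distrib]
  refine Finset.sum_congr rfl fun u _ => ?_
  rw [G.degree_eq_sum_if_adj, Finset.sum_mul, Finset.sum_mul, ← Finset.sum_add_distrib]
  refine Finset.sum_congr rfl fun v _ => ?_
  rw [G.adjMatrix_apply]
  split_ifs <;> ring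

theorem SimpleGraph.CliqueFree.adjMatrix_mul_mul_eq_zero {V : Type*} {G : SimpleGraph V}
    [DecidableRel G.Adj] (hG : G.CliqueFree 3) (x u v : V) :
    G.adjMatrix ℝ u v * (G.adjMatrix ℝ x u * G.adjMatrix ℝ x v) = 0 := by
  classical
  simp only [SimpleGraph.adjMatrix_apply]
  split_ifs with huv hxu hxv <;> try simp
  exact hG {x, u, v} (SimpleGraph.is3Clique_triple_iff.2 ⟨hxu, hxv, huv⟩)

/-- If `G` is a triangle-free graph and `xy` is an edge of `G`, then
`(deg x + deg y) * qₙ(G) ≤ w_x + w_y - 2 * m_{xy}`, where `qₙ(G)` is the smallest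
eigenvalue of the signless Laplacian matrix of `G`. -/
theorem signless_laplacian_smallest_eigenvalue_edge_bound
    {V : Type*} [Fintype V] [DecidableEq V] [Nonempty V]
    (G : SimpleGraph V) [DecidableRel G.Adj]
    (hG : G.CliqueFree 3) (x y : V) (hxy : G.Adj x y)
    (hQ : (G.degMatrix ℝ + G.adjMatrix ℝ).IsHermitian) :
    ((G.degree x : ℝ) + G.degree y) * (⨅ i, hQ.eigenvalues i) ≤
      (wWalk G x : ℝ) + wWalk G y - 2 * mCount G x y := by
  set a := G.adjMatrix ℝ x with ha
  set b := G.adjMatrix ℝ y with hb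
  have hsq (z u : V) : G.adjMatrix ℝ z u ^ 2 = G.adjMatrix ℝ z u := by
    simp [SimpleGraph.adjMatrix_apply]
  have hab (u : V) : a u * b u = 0 := by
    have h := hG.adjMatrix_mul_mul_eq_zero u x y
    rw [SimpleGraph.adjMatrix_apply, if_pos hxy, one_mul] at h
    simpa [ha, hb, SimpleGraph.adjMatrix_apply, G.adj_comm u] using h
  have hdeg (z : V) : (G.degree z : ℝ) = ∑ u, G.adjMatrix ℝ z u := by
    simp [G.degree_eq_sum_if_adj, SimpleGraph.adjMatrix_apply]
  have hnorm : (a - b) ⬝ᵥ (a - b) = G.degree x + G.degree y := by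
    rw [hdeg, hdeg, ← Finset.sum_add_distrib]
    refine Finset.sum_congr rfl fun u _ => ?_
    simp only [Pi.sub_apply]
    linear_combination hsq x u + hsq y u - 2 * hab u
  have hm : ∑ u, ∑ v, G.adjMatrix ℝ u v * (b u * a v) = mCount G x y := by
    rw [natCast_mCount_eq_sum, Finset.sum_comm]
    refine Finset.sum_congr rfl fun u _ => Finset.sum_congr rfl fun v _ => ?_
    rw [← G.transpose_adjMatrix, Matrix.transpose_apply, G.transpose_adjMatrix, mul_comm (b v)]
  have hquad : (a - b) ⬝ᵥ ((G.degMatrix ℝ + G.adjMatrix ℝ).mulVec (a - b)) =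
      wWalk G x + wWalk G y - 2 * mCount G x y := by
    rw [two_mul, ← sub_sub]
    nth_rw 2 [← hm]
    rw [G.dotProduct_degMatrix_add_adjMatrix_mulVec, natCast_wWalk_eq_sum, natCast_wWalk_eq_sum,
      natCast_mCount_eq_sum]
    simp only [← Finset.sum_add_distrib, ← Finset.sum_sub_distrib]
    refine Finset.sum_congr rfl fun u _ => Finset.sum_congr rfl fun v _ => ?_
    simp only [Pi.sub_apply]
    linear_combination G.adjMatrix ℝ u v * (hsq x u + hsq y u - 2 * hab u) +
      hG.adjMatrix_mul_mul_eq_zero x u v + hG.adjMatrix_mul_mul_eq_zero y u v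
  rw [← hnorm, ← hquad, mul_comm]
  exact hQ.iInf_eigenvalues_mul_dotProduct_le (a - b)
end

section
/- Let G be a triangle-free simple graph and let xy be an edge of G. Define the vector z ∈ ℝ^{V(G)} by z_v = +1 if xv ∈ E(G), z_v = −1 if yv ∈ E(G), and z_v = 0 otherwise (well-defined since G is triangle-free). Then, with Q the signless Laplacian matrix of G, one has z^T Q z = w_x + w_y − 2·m_{xy} and ‖z‖² = deg(x) + deg(y). -/
open Matrix

theorem wWalk_eq_sum_degree {V : Type*} [Fintype V] (G : SimpleGraph V) [DecidableRel G.Adj]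
    (x : V) : (wWalk G x : ℝ) = ∑ u, if G.Adj x u then (G.degree u : ℝ) else 0 := by
  rw [wWalk, Nat.card_eq_fintype_card, Fintype.card_subtype, Finset.card_filter,
    Fintype.sum_prod_type]
  push_cast
  refine Finset.sum_congr rfl fun u _ => ?_
  by_cases h : G.Adj x u
  · simp [h, ← G.card_neighborFinset_eq_degree, G.neighborFinset_eq_filter]
  · simp [h]

theorem mCount_eq_sum {V : Type*} [Fintype V] (G : SimpleGraph V) [DecidableRel G.Adj]
    (x y : V) :
    (mCount G x y : ℝ) =
      ∑ u, ∑ v, if G.Adj u v ∧ G.Adj u x ∧ G.Adj v y then (1 : ℝ) else 0 := by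
  rw [mCount, Nat.card_eq_fintype_card, Fintype.card_subtype, Finset.card_filter,
    Fintype.sum_prod_type]
  push_cast
  rfl

theorem SimpleGraph.CliqueFree.not_adj_of_adj_of_adj {V : Type*} {G : SimpleGraph V}
    (hG : G.CliqueFree 3) {a b c : V} (hab : G.Adj a b) (hac : G.Adj a c) : ¬ G.Adj b c := by
  classical
  exact fun hbc => hG {a, b, c} (SimpleGraph.is3Clique_triple_iff.2 ⟨hab, hac, hbc⟩)

/-- Let `G` be a triangle-free graph, `xy ∈ E(G)`, and let `z` be the vector with
`z_v = 1` if `xv ∈ E(G)`, `z_v = -1` if `yv ∈ E(G)` and `z_v = 0` otherwise.  Then, with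
`Q = D + A` the signless Laplacian of `G`, we have `zᵀ Q z = w_x + w_y - 2 m_{xy}` and
`‖z‖² = deg x + deg y`. -/
theorem signless_laplacian_quadratic_form_eval
    {V : Type*} [Fintype V] [DecidableEq V]
    (G : SimpleGraph V) [DecidableRel G.Adj]
    (hG : G.CliqueFree 3) (x y : V) (hxy : G.Adj x y)
    (z : V → ℝ)
    (hz : ∀ v, z v = if G.Adj x v then 1 else if G.Adj y v then -1 else 0) :
    z ⬝ᵥ ((G.degMatrix ℝ + G.adjMatrix ℝ) *ᵥ z) =
        (wWalk G x : ℝ) + wWalk G y - 2 * mCount G x y ∧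
      ∑ v, z v ^ 2 = (G.degree x : ℝ) + G.degree y := by
  have hxy_disj (v : V) (hx : G.Adj x v) : ¬ G.Adj y v := hG.not_adj_of_adj_of_adj hxy hx
  constructor
  · have hdeg : z ⬝ᵥ (G.degMatrix ℝ *ᵥ z) = (wWalk G x : ℝ) + wWalk G y := by
      rw [wWalk_eq_sum_degree, wWalk_eq_sum_degree, ← Finset.sum_add_distrib]
      refine Finset.sum_congr rfl fun v _ => ?_
      rw [SimpleGraph.degMatrix, mulVec_diagonal, hz]
      have := hxy_disj v
      split_ifs <;> simp_all
    have hadj : z ⬝ᵥ (G.adjMatrix ℝ *ᵥ z) = -(mCount G x y : ℝ) - mCount G x y := by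
      have hswap : (mCount G x y : ℝ) =
          ∑ u, ∑ v, if G.Adj v u ∧ G.Adj v x ∧ G.Adj u y then (1 : ℝ) else 0 := by
        rw [mCount_eq_sum, Finset.sum_comm]
      nth_rewrite 2 [hswap]
      rw [mCount_eq_sum, ← Finset.sum_neg_distrib, ← Finset.sum_sub_distrib]
      refine Finset.sum_congr rfl fun u _ => ?_
      rw [← Finset.sum_neg_distrib, ← Finset.sum_sub_distrib, mulVec, dotProduct, Finset.mul_sum]
      refine Finset.sum_congr rfl fun v _ => ?_
      rw [SimpleGraph.adjMatrix_apply, hz, hz]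
      simp only [G.adj_comm v u, G.adj_comm u x, G.adj_comm v x, G.adj_comm u y, G.adj_comm v y]
      by_cases huv : G.Adj u v
      · have hu := hxy_disj u
        have hv := hxy_disj v
        have hx : G.Adj x u → ¬ G.Adj x v := fun h h' => hG.not_adj_of_adj_of_adj h h' huv
        have hy : G.Adj y u → ¬ G.Adj y v := fun h h' => hG.not_adj_of_adj_of_adj h h' huv
        by_cases G.Adj x u <;> by_cases G.Adj x v <;> by_cases G.Adj y u <;>
          by_cases G.Adj y v <;> simp_all
      · simp [huv]
    rw [add_mulVec, dotProduct_add, hdeg, hadj]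
    ring
  · rw [← G.card_neighborFinset_eq_degree x, ← G.card_neighborFinset_eq_degree y,
      G.neighborFinset_eq_filter, G.neighborFinset_eq_filter, Finset.card_filter,
      Finset.card_filter]
    push_cast
    rw [← Finset.sum_add_distrib]
    refine Finset.sum_congr rfl fun v _ => ?_
    rw [hz]
    have := hxy_disj v
    split_ifs <;> simp_all
end

section
/- Let G be a triangle-free simple graph. Then Σ_{xy ∈ E(G)} (w_x + w_y − 2·m_{xy}) = hom_s(P_4, G), where the sum runs over the edges of G. -/
lemma mCount_symm {V : Type*} (G : SimpleGraph V) (x y : V) :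
    mCount G x y = mCount G y x :=
  Nat.card_congr <| (Equiv.prodComm V V).subtypeEquiv fun p => by
    constructor
    · rintro ⟨h1, h2, h3⟩; exact ⟨h1.symm, h3, h2⟩
    · rintro ⟨h1, h2, h3⟩; exact ⟨h1.symm, h3, h2⟩

/-- `homS H G` is the number of strong homomorphisms from `H` to `G`, i.e. maps
`φ : V(H) → V(G)` such that `uv ∈ E(H)` if and only if `φ(u)φ(v) ∈ E(G)`. -/
noncomputable def homS {W V : Type*} (H : SimpleGraph W) (G : SimpleGraph V) : ℕ :=
  Nat.card {φ : W → V // ∀ u v, H.Adj u v ↔ G.Adj (φ u) (φ v)}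

/-- Summing a symmetrized function over the edges is the same as summing the function over
the darts. -/
lemma SimpleGraph.sum_edgeFinset_eq_sum_darts {V M : Type*} [Fintype V] [DecidableEq V]
    [AddCommMonoid M] (G : SimpleGraph V) [DecidableRel G.Adj] (F : Sym2 V → M) (g : V → V → M)
    (hF : ∀ x y, F s(x, y) = g x y + g y x) :
    ∑ e ∈ G.edgeFinset, F e = ∑ d : G.Dart, g d.fst d.snd := by
  rw [← Finset.sum_fiberwise_of_maps_to (s := Finset.univ) (t := G.edgeFinset)
    (g := SimpleGraph.Dart.edge) (fun d _ => SimpleGraph.mem_edgeFinset.2 d.edge_mem)]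
  refine Finset.sum_congr rfl fun e he => ?_
  induction e with
  | h x y =>
    let d : G.Dart := ⟨(x, y), SimpleGraph.mem_edgeFinset.1 he⟩
    have hd : s(x, y) = d.edge := rfl
    rw [hF, hd, d.edge_fiber, Finset.sum_pair d.symm_ne.symm]
    rfl

lemma wWalk_sub_mCount {V : Type*} [Finite V] (G : SimpleGraph V) (x y : V) :
    (wWalk G x : ℤ) - mCount G x y =
      Nat.card {p : V × V // G.Adj x p.1 ∧ G.Adj p.1 p.2 ∧ ¬ G.Adj p.2 y} := by
  classical
  have := Fintype.ofFinite V
  rw [sub_eq_iff_eq_add']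
  norm_cast
  simp only [wWalk, mCount, Nat.card_eq_fintype_card, Fintype.card_subtype]
  rw [← Finset.card_filter_add_card_filter_not (fun p : V × V => G.Adj p.2 y),
    Finset.filter_filter, Finset.filter_filter]
  congr 2 <;> ext p <;> simp [G.adj_comm x, and_assoc, and_left_comm]

/-- In a triangle-free graph, a strong homomorphism from the path on four vertices is a dart
followed by two further edges such that the ends of the resulting walk are not adjacent. -/
def SimpleGraph.CliqueFree.strongHomPathFourEquiv {V : Type*} {G : SimpleGraph V}
    (hG : G.CliqueFree 3) :
    {φ : Fin 4 → V // ∀ u v, (SimpleGraph.pathGraph 4).Adj u v ↔ G.Adj (φ u) (φ v)} ≃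
      Σ d : G.Dart, {p : V × V // G.Adj d.fst p.1 ∧ G.Adj p.1 p.2 ∧ ¬ G.Adj p.2 d.snd} where
  toFun φ := ⟨⟨(φ.1 1, φ.1 0), (φ.2 1 0).1 (by simp [SimpleGraph.pathGraph_adj])⟩,
    (φ.1 2, φ.1 3), (φ.2 1 2).1 (by simp [SimpleGraph.pathGraph_adj]),
    (φ.2 2 3).1 (by simp [SimpleGraph.pathGraph_adj]),
    fun h => by simpa [SimpleGraph.pathGraph_adj] using (φ.2 3 0).2 h⟩
  invFun q := ⟨![q.1.snd, q.1.fst, q.2.1.1, q.2.1.2], by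
    obtain ⟨⟨⟨x, y⟩, hxy⟩, ⟨u, v⟩, hxu, huv, hvy⟩ := q
    classical
    have hyu : ¬ G.Adj y u := fun h =>
      hG _ (SimpleGraph.is3Clique_triple_iff.2 ⟨hxy, hxu, h⟩)
    have hxv : ¬ G.Adj x v := fun h =>
      hG _ (SimpleGraph.is3Clique_triple_iff.2 ⟨hxu, h, huv⟩)
    dsimp only at hxy hxu huv hvy
    have hyv : ¬ G.Adj y v := fun h => hvy h.symm
    intro i j
    fin_cases i <;> fin_cases j <;>
      simp_all [SimpleGraph.pathGraph_adj, G.adj_comm]⟩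
  left_inv φ := by
    ext i
    fin_cases i <;> rfl
  right_inv _ := rfl

/-- If `G` is a triangle-free graph, then
`∑_{xy ∈ E(G)} (w_x + w_y - 2 m_{xy}) = hom_s(P₄, G)`. -/
theorem sum_edges_w_sub_m_eq_homS_path_four
    {V : Type*} [Fintype V] [DecidableEq V]
    (G : SimpleGraph V) [DecidableRel G.Adj]
    (hG : G.CliqueFree 3) :
    ∑ e ∈ G.edgeFinset,
        Sym2.lift ⟨fun x y => (wWalk G x : ℤ) + wWalk G y - 2 * mCount G x y,
          fun x y => by beta_reduce; rw [mCount_symm G x y]; ring⟩ e =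
      (homS (SimpleGraph.pathGraph 4) G : ℤ) := by
  rw [G.sum_edgeFinset_eq_sum_darts _ (fun x y => (wWalk G x : ℤ) - mCount G x y)
    fun x y => by rw [Sym2.lift_mk, mCount_symm G y x]; ring]
  simp only [wWalk_sub_mCount]
  rw [homS, Nat.card_congr hG.strongHomPathFourEquiv, Nat.card_sigma]
  push_cast
  rfl
end

section
/- Let G be a simple graph. Then 2·Σ_{xy ∈ E(G)} m_{xy} equals the number of maps φ : {1,2,3,4} → V(G) such that φ(1)φ(2), φ(2)φ(3), φ(3)φ(4), φ(4)φ(1) ∈ E(G). -/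
/-- Summing a function of the underlying edge over all darts counts every edge twice. -/
lemma SimpleGraph.sum_dart_edge {V M : Type*} [Fintype V] [DecidableEq V] [AddCommMonoid M]
    (G : SimpleGraph V) [DecidableRel G.Adj] (f : Sym2 V → M) :
    ∑ d : G.Dart, f d.edge = 2 • ∑ e ∈ G.edgeFinset, f e := by
  rw [← Finset.sum_fiberwise_of_maps_to (t := G.edgeFinset) (g := fun d : G.Dart => d.edge)
    (fun d _ => SimpleGraph.mem_edgeFinset.2 d.edge_mem), Finset.smul_sum]
  refine Finset.sum_congr rfl fun e he => ?_
  rw [Finset.sum_congr rfl fun d hd => congrArg f (Finset.mem_filter.1 hd).2, Finset.sum_const,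
    G.dart_edge_fiber_card e (SimpleGraph.mem_edgeFinset.1 he)]

/-- Closed walks `x, y, v, u` of length four correspond to darts `(x, y)` together with an adjacent
pair `(u, v)` such that `u` is adjacent to `x` and `v` is adjacent to `y`. -/
def closedWalkFourEquivSigmaDart {V : Type*} (G : SimpleGraph V) :
    {φ : Fin 4 → V //
      G.Adj (φ 0) (φ 1) ∧ G.Adj (φ 1) (φ 2) ∧ G.Adj (φ 2) (φ 3) ∧ G.Adj (φ 3) (φ 0)} ≃
    Σ d : G.Dart, {p : V × V // G.Adj p.1 p.2 ∧ G.Adj p.1 d.fst ∧ G.Adj p.2 d.snd} where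
  toFun φ := ⟨⟨(φ.1 0, φ.1 1), φ.2.1⟩,
    ⟨(φ.1 3, φ.1 2), φ.2.2.2.1.symm, φ.2.2.2.2, φ.2.2.1.symm⟩⟩
  invFun q := ⟨![q.1.fst, q.1.snd, q.2.1.2, q.2.1.1],
    q.1.adj, q.2.2.2.2.symm, q.2.2.1.symm, q.2.2.2.1⟩
  left_inv φ := by
    ext i
    fin_cases i <;> rfl
  right_inv _ := rfl

/-- For a simple graph `G`, twice the sum of `m_{xy}` over the edges `xy` of `G` equals the
number of maps `φ : {1,2,3,4} → V(G)` with
`φ(1)φ(2), φ(2)φ(3), φ(3)φ(4), φ(4)φ(1) ∈ E(G)`. -/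
theorem two_mul_sum_edges_m_eq_card_closed_walks_length_four
    {V : Type*} [Fintype V] [DecidableEq V]
    (G : SimpleGraph V) [DecidableRel G.Adj] :
    2 * ∑ e ∈ G.edgeFinset,
        Sym2.lift ⟨fun x y => mCount G x y, fun x y => by beta_reduce; rw [mCount_symm]⟩ e =
      Nat.card {φ : Fin 4 → V //
        G.Adj (φ 0) (φ 1) ∧ G.Adj (φ 1) (φ 2) ∧ G.Adj (φ 2) (φ 3) ∧ G.Adj (φ 3) (φ 0)} := by
  rw [← smul_eq_mul, ← SimpleGraph.sum_dart_edge, Nat.card_congr (closedWalkFourEquivSigmaDart G),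
    Nat.card_sigma]
  rfl
end

section
/- Let G be a triangle-free simple graph on n vertices. Then hom_s(P_4, G) ≤ (15/94)·n · hom_s(P_3, G). -/
namespace PathFour

/-- Linear form on the adjacency triple of a vertex to an independent triple. -/
def indepForm (a b c : Bool) : ℤ :=
  match a, b, c with
  | false, false, false => 0
  | true, true, true => 6
  | true, true, false | true, false, true | false, true, true => -4
  | _, _, _ => 1

/-- Linear form on the adjacency triple of a vertex to three vertices, the first two adjacent. -/
def edgeForm (r s t : ℤ) (a b c : Bool) : ℤ :=
  match a || b, c with
  | false, false => 0
  | true, false => r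
  | false, true => s
  | true, true => t

/-- Like `edgeForm`, but changing sign when the two ends of the edge are swapped. -/
def edgeSkewForm (r t : ℤ) (a b c : Bool) : ℤ :=
  (a.toInt - b.toInt) * if c then t else r

/-- Linear form on the adjacency triple of a vertex to the two ends and the centre of an induced
path. -/
def pathForm (q r s t : ℤ) (a b c : Bool) : ℤ :=
  match a, b, c with
  | false, false, false => q
  | _, _, true => r
  | true, true, false => t
  | _, _, false => s

/-- The penalty for a vertex adjacent to exactly one end of an induced path. -/
def endExcess (a b : Bool) : ℤ := if a = b then 0 else 1024

/-- The local certificate on three roots, with mutual adjacencies `x, y, z`, and two further vertices,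
with adjacency triples `a, b, c` and `a', b', c'` to the roots: a multiple of the weighted difference
between cherries and their extensions to induced paths, minus a sum of squares. -/
def cert (x y z : Bool) (a b c a' b' c' : Bool) : ℤ :=
  match x, y, z with
  | false, false, false =>
    -(40 * (indepForm a b c * indepForm a' b' c')
      + 120 * ((a.toInt - b.toInt) * (a'.toInt - b'.toInt)))
  | true, false, false =>
    -(150 * (edgeForm 1 2 (-3) a b c * edgeForm 1 2 (-3) a' b' c')
      + 250 * (edgeForm 1 0 (-2) a b c * edgeForm 1 0 (-2) a' b' c')
      + 261 * (edgeSkewForm 1 2 a b c * edgeSkewForm 1 2 a' b' c')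
      + 299 * (edgeSkewForm 1 0 a b c * edgeSkewForm 1 0 a' b' c')
      + 2770 * (edgeSkewForm 0 1 a b c * edgeSkewForm 0 1 a' b' c'))
  | false, true, true =>
    650 - endExcess a b - endExcess a' b'
      - (66 * (pathForm 1 (-3) 1 1 a b c * pathForm 1 (-3) 1 1 a' b' c')
      + 56 * (pathForm 2 (-1) 0 (-3) a b c * pathForm 2 (-1) 0 (-3) a' b' c'))
  | _, _, _ => 0

/-- The sum of `cert` over all choices of the three root vertices in a five-vertex graph whose
adjacencies `01, 02, 03, 04, 12, 13, 14, 23, 24, 34` are listed in this order. -/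
def certSum (a b c d e f g h i j : Bool) : ℤ :=
  cert e a b f h c g i d + cert f a c e h b g j d + cert g a d e i b f j c +
  cert h b c e f a i j d + cert i b d e g a h j c + cert j c d f g a h i b +
  cert b a e c h f d i g + cert c a f b h e d j g + cert d a g b i e c j f +
  cert h e f b c a i j g + cert i e g b d a h j f + cert j f g c d a h i e +
  cert a b e c f h d g i + cert c b h a f e d j i + cert d b i a g e c j h +
  cert f e h a c b g j i + cert g e i a d b f j h + cert j h i c d b f g e +
  cert a c f b e h d g j + cert b c h a e f d i j + cert d c j a g f b i h +
  cert e f h a b c g i j + cert g f j a d c e i h + cert i h j b d c e g f +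
  cert a d g b e i c f j + cert b d i a e g c h j + cert c d j a f g b h i +
  cert e g i a b d f h j + cert f g j a c d e h i + cert h i j b c d e f g

theorem certSum_nonneg : ∀ a b c d e f g h i j : Bool,
    (a && b && e || a && c && f || a && d && g || b && c && h || b && d && i ||
      c && d && j || e && f && h || e && g && i || f && g && j || h && i && j) = false →
    0 ≤ certSum a b c d e f g h i j := by
  decide +kernel

/-- Placements of the arguments of `cert` on five vertices, one for each choice of the three root
vertices with a distinguished last root. -/
def placements : List (Fin 5 → Fin 5) :=
  [![1, 2, 0, 3, 4], ![1, 3, 0, 2, 4], ![1, 4, 0, 2, 3], ![2, 3, 0, 1, 4], ![2, 4, 0, 1, 3],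
    ![3, 4, 0, 1, 2], ![0, 2, 1, 3, 4], ![0, 3, 1, 2, 4], ![0, 4, 1, 2, 3], ![2, 3, 1, 0, 4],
    ![2, 4, 1, 0, 3], ![3, 4, 1, 0, 2], ![0, 1, 2, 3, 4], ![0, 3, 2, 1, 4], ![0, 4, 2, 1, 3],
    ![1, 3, 2, 0, 4], ![1, 4, 2, 0, 3], ![3, 4, 2, 0, 1], ![0, 1, 3, 2, 4], ![0, 2, 3, 1, 4],
    ![0, 4, 3, 1, 2], ![1, 2, 3, 0, 4], ![1, 4, 3, 0, 2], ![2, 4, 3, 0, 1], ![0, 1, 4, 2, 3],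
    ![0, 2, 4, 1, 3], ![0, 3, 4, 1, 2], ![1, 2, 4, 0, 3], ![1, 3, 4, 0, 2], ![2, 3, 4, 0, 1]]

theorem injective_of_mem_placements : ∀ t ∈ placements, Function.Injective t := by
  intro t ht
  fin_cases ht <;> decide

section Sums

variable {V : Type*} [Fintype V]

theorem sum_fin_succ_arrow {M : Type*} [AddCommMonoid M] {k : ℕ} (f : (Fin (k + 1) → V) → M) :
    ∑ x, f x = ∑ a, ∑ y : Fin k → V, f (Matrix.vecCons a y) := by
  rw [← (Fin.consEquiv (fun _ => V)).sum_comp f, Fintype.sum_prod_type]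
  rfl

theorem sum_list_map_sum {ι α : Type*} [Fintype α] (l : List ι) (f : ι → α → ℤ) :
    ∑ x, (l.map fun t => f t x).sum = (l.map fun t => ∑ x, f t x).sum := by
  induction l with
  | nil => simp
  | cons t l ih => simp [Finset.sum_add_distrib, ih]

theorem sum_comp_injective {ι : Type*} [Fintype ι] [DecidableEq ι] {t : ι → ι}
    (ht : Function.Injective t) (F : (ι → V) → ℤ) : ∑ x : ι → V, F (x ∘ t) = ∑ x, F x :=
  ((Equiv.ofBijective t (Finite.injective_iff_bijective.mp ht)).symm.arrowCongr
    (Equiv.refl V)).sum_comp F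

theorem sum_sum_mul (g : V → ℤ) (k : ℤ) :
    ∑ u, ∑ v, k * (g u * g v) = k * (∑ u, g u) ^ 2 := by
  simp only [← Finset.mul_sum, ← Finset.sum_mul, sq]

theorem sum_cert_le (x y z : Bool) (f g h : V → Bool) :
    ∑ u, ∑ v, cert x y z (f u) (g u) (h u) (f v) (g v) (h v) ≤
      if !x && y && z then
        650 * (Fintype.card V : ℤ) ^ 2 -
          2048 * Fintype.card V * ∑ u, if f u = g u then 0 else 1
      else 0 := by
  have hsum (F : Bool → Bool → Bool → ℤ) (k : ℤ) :=
    sum_sum_mul (fun u => F (f u) (g u) (h u)) k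
  cases x <;> cases y <;> cases z
  case false.false.false =>
    simp only [cert, Finset.sum_neg_distrib, Finset.sum_add_distrib]
    rw [hsum indepForm, hsum (fun a b _ => a.toInt - b.toInt)]
    simp only [Bool.not_false, Bool.and_false, Bool.false_eq_true, if_false]
    linarith [sq_nonneg (∑ u, indepForm (f u) (g u) (h u)),
      sq_nonneg (∑ u, ((f u).toInt - (g u).toInt))]
  case true.false.false =>
    simp only [cert, Finset.sum_neg_distrib, Finset.sum_add_distrib]
    simp only [hsum (edgeForm _ _ _), hsum (edgeSkewForm _ _)]
    simp only [Bool.and_false, Bool.false_eq_true, if_false]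
    have h1 (r s t : ℤ) := sq_nonneg (∑ u, edgeForm r s t (f u) (g u) (h u))
    have h2 (r t : ℤ) := sq_nonneg (∑ u, edgeSkewForm r t (f u) (g u) (h u))
    linarith [h1 1 2 (-3), h1 1 0 (-2), h2 1 2, h2 1 0, h2 0 1]
  case false.true.true =>
    simp only [cert, endExcess, Finset.sum_sub_distrib, Finset.sum_add_distrib]
    simp only [hsum (pathForm _ _ _ _)]
    have h1 (q r s t : ℤ) := sq_nonneg (∑ u, pathForm q r s t (f u) (g u) (h u))
    have h2 : ∑ u, (if f u = g u then (0 : ℤ) else 1024) =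
        1024 * ∑ u, if f u = g u then (0 : ℤ) else 1 := by
      simp [Finset.mul_sum]
    simp only [Finset.sum_const, Finset.card_univ, nsmul_eq_mul, ← Finset.mul_sum, h2]
    simp only [Bool.not_false, Bool.and_true, if_true]
    linarith [h1 1 (-3) 1 1, h1 2 (-1) 0 (-3)]
  all_goals simp [cert]

end Sums

variable {V : Type*} [Fintype V] (A : V → V → Bool)

/-- `cert` evaluated on the adjacencies of a `5`-tuple of vertices. -/
def certAt (x : Fin 5 → V) : ℤ :=
  cert (A (x 0) (x 1)) (A (x 0) (x 2)) (A (x 1) (x 2))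
    (A (x 0) (x 3)) (A (x 1) (x 3)) (A (x 2) (x 3)) (A (x 0) (x 4)) (A (x 1) (x 4)) (A (x 2) (x 4))

theorem sum_certAt_nonneg (symm : ∀ u v, A u v = A v u)
    (tri : ∀ u v w, (A u v && A u w && A v w) = false) : 0 ≤ ∑ x, certAt A x := by
  have hsum : (∑ x : Fin 5 → V, (placements.map fun t => certAt A (x ∘ t)).sum) =
      30 * ∑ x, certAt A x := by
    have hconst : placements.map (fun t => ∑ x : Fin 5 → V, certAt A (x ∘ t)) =
        placements.map fun _ => ∑ x, certAt A x :=
      List.map_congr_left fun t ht =>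
        sum_comp_injective (injective_of_mem_placements t ht) (certAt A)
    rw [sum_list_map_sum, hconst, List.map_const', List.sum_replicate, nsmul_eq_mul]
    rfl
  have hnonneg : 0 ≤ ∑ x : Fin 5 → V, (placements.map fun t => certAt A (x ∘ t)).sum := by
    refine Finset.sum_nonneg fun x _ => ?_
    have h := certSum_nonneg (A (x 0) (x 1)) (A (x 0) (x 2)) (A (x 0) (x 3)) (A (x 0) (x 4))
      (A (x 1) (x 2)) (A (x 1) (x 3)) (A (x 1) (x 4)) (A (x 2) (x 3)) (A (x 2) (x 4))
      (A (x 3) (x 4)) (by simp only [tri, Bool.or_false])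
    refine h.trans_eq ?_
    simp [placements, certAt, certSum, symm (x 1) (x 0), symm (x 2) (x 0), symm (x 3) (x 0),
      symm (x 4) (x 0), symm (x 2) (x 1), symm (x 3) (x 1), symm (x 4) (x 1), symm (x 3) (x 2),
      symm (x 4) (x 2), symm (x 4) (x 3), add_assoc]
  linarith

/-- `a` and `b` are the ends of an induced path with centre `c`. -/
def isCherry (a b c : V) : Bool := !A a b && A a c && A b c

theorem sum_certAt_le :
    ∑ x, certAt A x ≤ Fintype.card V *
      (650 * Fintype.card V * (∑ a, ∑ b, ∑ c, if isCherry A a b c then 1 else 0) -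
        2048 * ∑ a, ∑ b, ∑ c, ∑ u,
          if isCherry A a b c then if A a u = A b u then 0 else 1 else 0) := by
  have hexp : ∑ x, certAt A x = ∑ a, ∑ b, ∑ c, ∑ u, ∑ v, cert (A a b) (A a c) (A b c)
      (A a u) (A b u) (A c u) (A a v) (A b v) (A c v) := by
    simp only [sum_fin_succ_arrow, Fintype.sum_unique]
    rfl
  rw [hexp, mul_sub, mul_left_comm, ← mul_assoc, mul_left_comm]
  simp only [Finset.mul_sum, ← Finset.sum_sub_distrib]
  refine Finset.sum_le_sum fun a _ => Finset.sum_le_sum fun b _ => Finset.sum_le_sum fun c _ => ?_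
  refine (sum_cert_le _ _ _ (A a) (A b) (A c)).trans (le_of_eq ?_)
  unfold isCherry
  split_ifs
  · have hmul : ∑ u, 2048 * ((Fintype.card V : ℤ) * if A a u = A b u then 0 else 1) =
        2048 * Fintype.card V * ∑ u, if A a u = A b u then 0 else 1 := by
      simp only [Finset.mul_sum, mul_assoc]
    rw [hmul]
    ring
  · simp

theorem sum_ends_eq (symm : ∀ u v, A u v = A v u) :
    ∑ a, ∑ b, ∑ c, ∑ u, (if isCherry A a b c then if A a u = A b u then 0 else 1 else 0 : ℤ) =
      2 * ∑ a, ∑ b, ∑ c, ∑ u, if isCherry A a b c && A b u && !A a u then 1 else 0 := by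
  have hswap : ∑ a, ∑ b, ∑ c, ∑ u, (if isCherry A a b c && A a u && !A b u then 1 else 0 : ℤ) =
      ∑ a, ∑ b, ∑ c, ∑ u, if isCherry A a b c && A b u && !A a u then 1 else 0 := by
    rw [Finset.sum_comm]
    refine Finset.sum_congr rfl fun a _ => Finset.sum_congr rfl fun b _ =>
      Finset.sum_congr rfl fun c _ => Finset.sum_congr rfl fun u _ => ?_
    have : isCherry A b a c = isCherry A a b c := by
      rw [isCherry, isCherry, symm b a, Bool.and_assoc, Bool.and_assoc, Bool.and_comm (A b c)]
    rw [this]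
  rw [two_mul]
  nth_rw 2 [← hswap]
  simp only [← Finset.sum_add_distrib]
  refine Finset.sum_congr rfl fun a _ => Finset.sum_congr rfl fun b _ =>
    Finset.sum_congr rfl fun c _ => Finset.sum_congr rfl fun u _ => ?_
  cases isCherry A a b c <;> cases A a u <;> cases A b u <;> simp

theorem homS_path_three_eq {V : Type*} [Fintype V] (G : SimpleGraph V) (A : V → V → Bool)
    (hA : ∀ u v, A u v = true ↔ G.Adj u v) :
    (homS (SimpleGraph.pathGraph 3) G : ℤ) =
      ∑ a, ∑ b, ∑ c, if isCherry A a b c then 1 else 0 := by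
  classical
  rw [homS, Nat.card_eq_fintype_card, Fintype.card_subtype, Finset.card_filter]
  simp only [sum_fin_succ_arrow, Fintype.sum_unique]
  push_cast
  refine Finset.sum_congr rfl fun a _ => ?_
  rw [Finset.sum_comm]
  refine Finset.sum_congr rfl fun b _ => Finset.sum_congr rfl fun c _ => ?_
  refine if_congr ?_ rfl rfl
  simp [Fin.forall_fin_succ, SimpleGraph.pathGraph_adj, isCherry, ← hA]
  have loop (v : V) : A v v = false := by simp [← Bool.not_eq_true, hA]
  have symm (u v : V) : A u v = A v u := by rw [Bool.eq_iff_iff, hA, hA, G.adj_comm]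
  rw [symm b a, symm c a, symm c b]
  simp only [loop]
  tauto

theorem homS_path_four_le {V : Type*} [Fintype V] (G : SimpleGraph V) (A : V → V → Bool)
    (hA : ∀ u v, A u v = true ↔ G.Adj u v) :
    (homS (SimpleGraph.pathGraph 4) G : ℤ) ≤
      ∑ a, ∑ b, ∑ c, ∑ u, if isCherry A a b c && A b u && !A a u then 1 else 0 := by
  classical
  rw [homS, Nat.card_eq_fintype_card, Fintype.card_subtype, Finset.card_filter]
  simp only [sum_fin_succ_arrow, Fintype.sum_unique]
  push_cast
  refine Finset.sum_le_sum fun a _ => ?_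
  rw [Finset.sum_comm]
  refine Finset.sum_le_sum fun b _ => Finset.sum_le_sum fun c _ => Finset.sum_le_sum fun u _ => ?_
  split_ifs with h1 h2
  · rfl
  · refine absurd ?_ h2
    have h01 := h1 0 1
    have h12 := h1 1 2
    have h23 := h1 2 3
    have h02 := h1 0 2
    have h03 := h1 0 3
    simp [SimpleGraph.pathGraph_adj, ← hA] at h01 h12 h23 h02 h03
    have symm : A b c = A c b := by rw [Bool.eq_iff_iff, hA, hA, G.adj_comm]
    simp [isCherry, h01, h12, h23, h02, h03, symm]
  · simp
  · simp

end PathFour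

open PathFour

/-- If `G` is a triangle-free graph on `n` vertices, then
`hom_s(P₄, G) ≤ (15/94) * n * hom_s(P₃, G)`. -/
theorem homS_path_four_le_homS_path_three
    {V : Type*} [Fintype V]
    (G : SimpleGraph V) (hG : G.CliqueFree 3) :
    (homS (SimpleGraph.pathGraph 4) G : ℝ) ≤
      (15 / 94) * (Fintype.card V : ℝ) * (homS (SimpleGraph.pathGraph 3) G : ℝ) := by
  classical
  set A : V → V → Bool := fun u v => decide (G.Adj u v)
  have hA (u v) : A u v = true ↔ G.Adj u v := decide_eq_true_iff
  have symm (u v) : A u v = A v u := by simp only [A, G.adj_comm]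
  have tri (u v w) : (A u v && A u w && A v w) = false := by
    by_contra h
    simp only [Bool.not_eq_false, Bool.and_eq_true, hA] at h
    exact hG _ (SimpleGraph.is3Clique_triple_iff.mpr ⟨h.1.1, h.1.2, h.2⟩)
  have hsum := (sum_certAt_nonneg A symm tri).trans (sum_certAt_le A)
  have h4 := homS_path_four_le G A hA
  rw [sum_ends_eq A symm, ← homS_path_three_eq G A hA] at hsum
  rcases isEmpty_or_nonempty V with hV | hV
  · have h0 : homS (SimpleGraph.pathGraph 4) G = 0 := by
      simpa using h4
    simp [h0]
  · have hn : (0 : ℤ) < Fintype.card V := by exact_mod_cast Fintype.card_pos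
    have hmain : (4096 : ℤ) * homS (SimpleGraph.pathGraph 4) G ≤
        650 * Fintype.card V * homS (SimpleGraph.pathGraph 3) G := by
      linarith [nonneg_of_mul_nonneg_right hsum hn]
    have hmain' : (4096 : ℝ) * homS (SimpleGraph.pathGraph 4) G ≤
        650 * Fintype.card V * homS (SimpleGraph.pathGraph 3) G := by exact_mod_cast hmain
    have hpos : (0 : ℝ) ≤ Fintype.card V * homS (SimpleGraph.pathGraph 3) G := by positivity
    linarith
end

section
/- Let G be a d-regular simple graph on n vertices. Then D_2(G) ≥ ((λ_1(G) + λ_n(G))/4)·n, where D_2(G) is the minimum number of edges whose removal makes G bipartite, and λ_1(G), λ_n(G) are the largest and smallest eigenvalues of the adjacency matrix of G (so λ_1(G) = d). -/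
/-- `D2 G` is the minimum number of edges which have to be removed from `G` to make it
bipartite: the minimum over all vertex subsets `S` of the number of edges with both
endpoints in `S` plus the number of edges with both endpoints outside `S`. -/
noncomputable def D2 {V : Type*} [Fintype V] [DecidableEq V]
    (G : SimpleGraph V) [DecidableRel G.Adj] : ℕ :=
  ⨅ S : Finset V,
    ((G.edgeFinset.filter fun e => ∀ v ∈ e, v ∈ S).card +
      (G.edgeFinset.filter fun e => ∀ v ∈ e, v ∉ S).card)

theorem Matrix.IsHermitian.mul_dotProduct_self_le {n : Type*} [Fintype n] [DecidableEq n]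
    {A : Matrix n n ℝ} (hA : A.IsHermitian) {c : ℝ} (hc : ∀ i, c ≤ hA.eigenvalues i)
    (x : n → ℝ) : c * (x ⬝ᵥ x) ≤ x ⬝ᵥ A.mulVec x := by
  have hpsd : (A - algebraMap ℝ (Matrix n n ℝ) c).PosSemidef := by
    rw [Matrix.posSemidef_iff_isHermitian_and_spectrum_nonneg]
    refine ⟨hA.sub (by simp [Matrix.algebraMap_eq_diagonal]), ?_⟩
    rw [← spectrum.sub_singleton_eq, hA.spectrum_real_eq_range_eigenvalues]
    rintro _ ⟨_, ⟨i, rfl⟩, _, rfl, rfl⟩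
    exact sub_nonneg.2 (hc i)
  have h := hpsd.dotProduct_mulVec_nonneg x
  rw [star_trivial, Algebra.algebraMap_eq_smul_one, Matrix.sub_mulVec, Matrix.smul_mulVec,
    Matrix.one_mulVec, dotProduct_sub, dotProduct_smul, smul_eq_mul] at h
  linarith

namespace SimpleGraph

variable {V : Type*} [Fintype V] [DecidableEq V] (G : SimpleGraph V) [DecidableRel G.Adj]

theorem sum_adj_eq_two_nsmul_sum_edgeFinset {M : Type*} [AddCommMonoid M] (f : Sym2 V → M) :
    (∑ i, ∑ j, if G.Adj i j then f s(i, j) else 0) = 2 • ∑ e ∈ G.edgeFinset, f e := by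
  calc
    _ = ∑ p : V × V with G.Adj p.1 p.2, f s(p.1, p.2) := by
      rw [Finset.sum_filter, Fintype.sum_prod_type]
    _ = ∑ a : G.Dart, f a.edge := by
      symm
      refine Finset.sum_bij' (fun a _ => a.toProd) (fun p h => ⟨p, (Finset.mem_filter.1 h).2⟩)
        ?_ ?_ ?_ ?_ ?_ <;> simp [Dart.edge]
    _ = ∑ e ∈ G.edgeFinset, ∑ a : G.Dart with a.edge = e, f a.edge :=
      (Finset.sum_fiberwise_of_maps_to (fun a _ => mem_edgeFinset.2 a.edge_mem) _).symm
    _ = ∑ e ∈ G.edgeFinset, 2 • f e := by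
      refine Finset.sum_congr rfl fun e he => ?_
      rw [Finset.sum_congr rfl fun a ha => congrArg f (Finset.mem_filter.1 ha).2,
        Finset.sum_const, G.dart_edge_fiber_card e (mem_edgeFinset.1 he)]
    _ = _ := Finset.sum_nsmul _ _ _

variable {G} {d : ℕ}

theorem IsRegularOfDegree.eigenvalues_adjMatrix_le (hreg : G.IsRegularOfDegree d)
    (hA : (G.adjMatrix ℝ).IsHermitian) (i : V) : hA.eigenvalues i ≤ d := by
  have hL : G.lapMatrix ℝ = algebraMap ℝ (Matrix V V ℝ) d - G.adjMatrix ℝ := by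
    simp only [lapMatrix, degMatrix, hreg.degree_eq, Matrix.algebraMap_eq_diagonal]
    rfl
  have h := (Matrix.posSemidef_iff_isHermitian_and_spectrum_nonneg.1 (G.posSemidef_lapMatrix ℝ)).2
  rw [hL, ← spectrum.singleton_sub_eq, hA.spectrum_real_eq_range_eigenvalues] at h
  exact sub_nonneg.1 (h ⟨_, rfl, _, ⟨i, rfl⟩, rfl⟩)

/-- The quadratic form of the adjacency matrix at the `±1` indicator vector of `S`. -/
theorem dotProduct_mulVec_adjMatrix_sign (G : SimpleGraph V) [DecidableRel G.Adj]
    (S : Finset V) :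
    (fun v => if v ∈ S then (1 : ℝ) else -1) ⬝ᵥ
        (G.adjMatrix ℝ).mulVec (fun v => if v ∈ S then (1 : ℝ) else -1) =
      4 * ((G.edgeFinset.filter fun e => ∀ v ∈ e, v ∈ S).card +
        (G.edgeFinset.filter fun e => ∀ v ∈ e, v ∉ S).card) - 2 * G.edgeFinset.card := by
  let f : Sym2 V → ℝ := fun e =>
    2 * ((if ∀ v ∈ e, v ∈ S then 1 else 0) + (if ∀ v ∈ e, v ∉ S then 1 else 0)) - 1
  have hf (i j : V) :
      (if i ∈ S then (1 : ℝ) else -1) * (if j ∈ S then (1 : ℝ) else -1) = f s(i, j) := by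
    by_cases hi : i ∈ S <;> by_cases hj : j ∈ S <;> norm_num [f, hi, hj]
  rw [dotProduct_mulVec_adjMatrix]
  simp_rw [hf]
  rw [sum_adj_eq_two_nsmul_sum_edgeFinset]
  simp only [f, Finset.sum_sub_distrib, ← Finset.mul_sum, Finset.sum_add_distrib,
    Finset.sum_boole, Finset.sum_const, nsmul_eq_mul]
  push_cast
  ring

end SimpleGraph

/-- (Brandt) If `G` is a `d`-regular graph on `n` vertices, then
`D₂(G) ≥ ((λ₁(G) + λₙ(G)) / 4) * n`, where `λ₁(G)` and `λₙ(G)` are the largest and the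
smallest eigenvalues of the adjacency matrix of `G`. -/
theorem D2_ge_regular_adj_eigenvalues
    {V : Type*} [Fintype V] [DecidableEq V] [Nonempty V]
    (G : SimpleGraph V) [DecidableRel G.Adj] (d : ℕ)
    (hreg : G.IsRegularOfDegree d)
    (hA : (G.adjMatrix ℝ).IsHermitian) :
    (D2 G : ℝ) ≥ ((⨆ i, hA.eigenvalues i) + (⨅ i, hA.eigenvalues i)) / 4 *
      (Fintype.card V : ℝ) := by
  obtain ⟨S, hS⟩ : D2 G ∈ Set.range _ := Nat.sInf_mem (Set.range_nonempty _)
  have hsup : ⨆ i, hA.eigenvalues i ≤ d := ciSup_le fun i => hreg.eigenvalues_adjMatrix_le hA i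
  have hquad := hA.mul_dotProduct_self_le
    (fun i => ciInf_le (Set.finite_range hA.eigenvalues).bddBelow i)
    (fun v => if v ∈ S then (1 : ℝ) else -1)
  have hnorm : ((fun v => if v ∈ S then (1 : ℝ) else -1) ⬝ᵥ
      fun v => if v ∈ S then (1 : ℝ) else -1) = Fintype.card V := by
    have h (v : V) : (if v ∈ S then (1 : ℝ) else -1) * (if v ∈ S then 1 else -1) = 1 := by
      split_ifs <;> norm_num
    simp only [dotProduct, h, Finset.sum_const, Finset.card_univ, nsmul_eq_mul, mul_one]
  have hdeg : (Fintype.card V : ℝ) * d = 2 * G.edgeFinset.card := by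
    have h := G.sum_degrees_eq_twice_card_edges
    simp only [hreg.degree_eq, Finset.sum_const, Finset.card_univ, smul_eq_mul] at h
    exact_mod_cast h
  rw [G.dotProduct_mulVec_adjMatrix_sign, hnorm] at hquad
  rw [← hS]
  push_cast
  have := mul_le_mul_of_nonneg_left hsup (Nat.cast_nonneg (α := ℝ) (Fintype.card V))
  linarith
end
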